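/- arXiv:1006.3970 — 3 statements merged into one kernel-verified Lean document; each statement's English description precedes it below -/
import Mathlib

section
/- For every integer r > 0 there exists a constant C = C(r) such that the following holds. Let G = (V,E) be a finite connected graph with |V| ≥ r+3 admitting a tree decomposition of width at most r, let w : E → ℝ_{>0} be edge lengths, and let d be the shortest-path metric of (G,w). Suppose there exist M > 0 and, for every set S ⊆ V with |S| = r+3, a probability distribution μ_S on functions g : S → {0,1}, such that: (consistency) for any two sets S, S' of size r+3, the distribution of g|_{S ∩ S'} for g ∼ μ_S equals the distribution of g|_{S ∩ S'} for g ∼ μ_{S'}; and (local isometry) for all x, y ∈ S, M · Pr_{g ∼ μ_S}[g(x) ≠ g(y)] = d(x,y). Then there exist m ∈ ℕ and a map φ : V → ℝ^m such that for all x, y ∈ V: d(x,y) ≤ ‖φ(x) − φ(y)‖₁ ≤ C · d(x,y); that is, d embeds into ℓ₁ with distortion at most C. -/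
open Finset

/-- A tree decomposition of a graph `G`: a family of bags indexed by the nodes of a tree
(a connected acyclic graph), covering all vertices and edges, such that for each vertex the
bags containing it induce a connected subtree. -/
structure TreeDecomp {V : Type} (G : SimpleGraph V) where
  ι : Type
  fintype_ι : Fintype ι
  T : SimpleGraph ι
  connected : T.Connected
  acyclic : T.IsAcyclic
  bags : ι → Finset V
  covers_vertices : ∀ v : V, ∃ i, v ∈ bags i
  covers_edges : ∀ u v : V, G.Adj u v → ∃ i, u ∈ bags i ∧ v ∈ bags i
  bags_connected : ∀ v : V, (T.induce {i | v ∈ bags i}).Connected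

/-- The total `w`-length of a walk. -/
noncomputable def walkLen {V : Type} (G : SimpleGraph V) (w : V → V → ℝ) {x y : V}
    (p : G.Walk x y) : ℝ :=
  (p.darts.map fun d => w d.toProd.1 d.toProd.2).sum

/-- The shortest-path metric of `(G, w)`. -/
noncomputable def spDist {V : Type} (G : SimpleGraph V) (w : V → V → ℝ) (x y : V) : ℝ :=
  sInf {ℓ : ℝ | ∃ p : G.Walk x y, ℓ = walkLen G w p}

/-- The real-valued indicator of a proposition. -/
noncomputable def propInd (p : Prop) : ℝ := open Classical in if p then 1 else 0

lemma propInd_true {p : Prop} (h : p) : propInd p = 1 := by simp [propInd, h]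

lemma propInd_false {p : Prop} (h : ¬p) : propInd p = 0 := by simp [propInd, h]

lemma propInd_nonneg (p : Prop) : 0 ≤ propInd p := by
  by_cases h : p <;> simp [propInd, h]

lemma propInd_mono {p q : Prop} (h : p → q) : propInd p ≤ propInd q := by
  by_cases hp : p
  · rw [propInd_true hp, propInd_true (h hp)]
  · rw [propInd_false hp]; exact propInd_nonneg q

/-- The expected distance `E |X - q|`. -/
noncomputable def meanDist {Ω : Type} [Fintype Ω] (P X : Ω → ℝ) (q : ℝ) : ℝ :=
  ∑ ω, P ω * |X ω - q|

/-- The mass of a predicate. -/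
noncomputable def mass {Ω : Type} [Fintype Ω] (P : Ω → ℝ) (p : Ω → Prop) : ℝ :=
  ∑ ω, P ω * propInd (p ω)

lemma mass_mono {Ω : Type} [Fintype Ω] {P : Ω → ℝ} (hP : ∀ ω, 0 ≤ P ω) {p q : Ω → Prop}
    (h : ∀ ω, p ω → q ω) : mass P p ≤ mass P q :=
  Finset.sum_le_sum fun ω _ => mul_le_mul_of_nonneg_left (propInd_mono (h ω)) (hP ω)

lemma trapezoid_bound {w a z : ℝ} (hw : 0 < w) :
    2 * w * propInd (z ∈ Set.Icc (a + w) (a + 2 * w)) ≤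
      |z - a| - |z - (a + w)| + |z - (a + 3 * w)| - |z - (a + 2 * w)| := by
  by_cases h : z ∈ Set.Icc (a + w) (a + 2 * w)
  · rw [propInd_true h]
    obtain ⟨h1, h2⟩ := h
    rw [abs_of_nonneg (by linarith : 0 ≤ z - a), abs_of_nonneg (by linarith : 0 ≤ z - (a + w)),
      abs_of_nonpos (by linarith : z - (a + 3 * w) ≤ 0),
      abs_of_nonpos (by linarith : z - (a + 2 * w) ≤ 0)]
    linarith
  · rw [propInd_false h]
    rcases abs_cases (z - a) with h1 | h1 <;> rcases abs_cases (z - (a + w)) with h2 | h2 <;>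
    rcases abs_cases (z - (a + 3 * w)) with h3 | h3 <;>
    rcases abs_cases (z - (a + 2 * w)) with h4 | h4 <;> linarith

lemma trapezoid_eq_zero {w a z : ℝ} (hw : 0 < w) (hz : z ∉ Set.Ioo a (a + 3 * w)) :
    |z - a| - |z - (a + w)| + |z - (a + 3 * w)| - |z - (a + 2 * w)| = 0 := by
  by_cases h : a < z
  · have h' : a + 3 * w ≤ z := by
      by_contra h2; exact hz ⟨h, not_le.1 h2⟩
    rw [abs_of_nonneg (by linarith), abs_of_nonneg (by linarith), abs_of_nonneg (by linarith),
      abs_of_nonneg (by linarith)]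
    linarith
  · rw [abs_of_nonpos (by linarith), abs_of_nonpos (by linarith), abs_of_nonpos (by linarith),
      abs_of_nonpos (by linarith)]
    linarith

/-- If `X` avoids an open interval, then the mass that `Y` puts on its middle third is controlled
by the decrease of the mean distances to the two endpoints of the middle third. -/
lemma mass_middle_third_le {Ω : Type} [Fintype Ω] {P : Ω → ℝ} (hP : ∀ ω, 0 ≤ P ω)
    {X Y : Ω → ℝ} {a w : ℝ} (hw : 0 < w) (hX : ∀ ω, X ω ∉ Set.Ioo a (a + 3 * w))
    (hXY : ∀ q, meanDist P Y q ≤ meanDist P X q) :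
    2 * w * mass P (fun ω => Y ω ∈ Set.Icc (a + w) (a + 2 * w)) ≤
      (meanDist P X (a + w) - meanDist P Y (a + w)) +
        (meanDist P X (a + 2 * w) - meanDist P Y (a + 2 * w)) := by
  have comb : ∀ Z : Ω → ℝ, meanDist P Z a - meanDist P Z (a + w) + meanDist P Z (a + 3 * w)
      - meanDist P Z (a + 2 * w) =
      ∑ ω, P ω * (|Z ω - a| - |Z ω - (a + w)| + |Z ω - (a + 3 * w)| - |Z ω - (a + 2 * w)|) := by
    intro Z
    simp only [meanDist, mul_add, mul_sub, Finset.sum_add_distrib, Finset.sum_sub_distrib]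
  have hX0 := comb X
  rw [Finset.sum_eq_zero fun ω _ => by rw [trapezoid_eq_zero hw (hX ω), mul_zero]] at hX0
  have hY0 : 2 * w * mass P (fun ω => Y ω ∈ Set.Icc (a + w) (a + 2 * w)) ≤
      meanDist P Y a - meanDist P Y (a + w) + meanDist P Y (a + 3 * w)
      - meanDist P Y (a + 2 * w) := by
    rw [comb Y, mass, Finset.mul_sum]
    refine Finset.sum_le_sum fun ω _ => ?_
    have := mul_le_mul_of_nonneg_left (trapezoid_bound (a := a) (z := Y ω) hw) (hP ω)
    linarith
  linarith [hXY a, hXY (a + 3 * w)]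

/-- The number of values of `X` in the open interval `(a, b)`. -/
noncomputable def valueCount {Ω : Type} [Fintype Ω] (X : Ω → ℝ) (a b : ℝ) : ℕ :=
  open Classical in ((univ.image X).filter (· ∈ Set.Ioo a b)).card

lemma valueCount_eq_zero {Ω : Type} [Fintype Ω] {X : Ω → ℝ} {a b : ℝ}
    (h : ∀ ω, X ω ∉ Set.Ioo a b) : valueCount X a b = 0 := by
  classical
  rw [valueCount, Finset.card_eq_zero, Finset.filter_eq_empty_iff]
  intro z hz
  obtain ⟨ω, -, rfl⟩ := Finset.mem_image.1 hz
  exact h ω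

lemma not_mem_of_valueCount_eq_zero {Ω : Type} [Fintype Ω] {X : Ω → ℝ} {a b : ℝ}
    (h : valueCount X a b ≤ 0) (ω : Ω) : X ω ∉ Set.Ioo a b := by
  classical
  have h0 := Nat.le_zero.1 h
  rw [valueCount, Finset.card_eq_zero, Finset.filter_eq_empty_iff] at h0
  exact h0 (Finset.mem_image_of_mem _ (mem_univ ω))

lemma mem_of_valueCount_le {Ω : Type} [Fintype Ω] {X : Ω → ℝ} {a b a' b' : ℝ}
    (hsub : Set.Ioo a' b' ⊆ Set.Ioo a b) (h : valueCount X a b ≤ valueCount X a' b') {ω : Ω}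
    (hω : X ω ∈ Set.Ioo a b) : X ω ∈ Set.Ioo a' b' := by
  classical
  have hss : (univ.image X).filter (· ∈ Set.Ioo a' b') ⊆ (univ.image X).filter (· ∈ Set.Ioo a b) :=
    Finset.monotone_filter_right _ fun z _ hz => hsub hz
  have := Finset.eq_of_subset_of_card_le hss (by simpa [valueCount] using h)
  have hm : X ω ∈ (univ.image X).filter (· ∈ Set.Ioo a b) :=
    Finset.mem_filter.2 ⟨Finset.mem_image_of_mem _ (mem_univ ω), hω⟩
  rw [← this] at hm
  exact (Finset.mem_filter.1 hm).2

/-- Among `k + 2` consecutive intervals, one contains no value. -/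
lemma exists_avoided_interval {Ω : Type} [Fintype Ω] {X : Ω → ℝ} {a w : ℝ} (hw : 0 < w) {k : ℕ}
    (h : valueCount X a (a + (k + 2) * w) ≤ k + 1) :
    ∃ l : Fin (k + 2), ∀ ω, X ω ∉ Set.Ioo (a + l * w) (a + l * w + w) := by
  classical
  by_contra! hcon
  choose z hz using hcon
  have hmem : ∀ l : Fin (k + 2), X (z l) ∈ (univ.image X).filter
      (· ∈ Set.Ioo a (a + (k + 2) * w)) := by
    intro l
    refine Finset.mem_filter.2 ⟨Finset.mem_image_of_mem _ (mem_univ _), ?_, ?_⟩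
    · have : (0 : ℝ) ≤ l * w := by positivity
      linarith [(hz l).1]
    · have hl : ((l : ℕ) : ℝ) + 1 ≤ k + 2 := by exact_mod_cast l.2
      nlinarith [(hz l).2]
  have hinj : Function.Injective fun l : Fin (k + 2) => X (z l) := by
    intro l l' (hll : X (z l) = X (z l'))
    by_contra hne
    have key : ∀ i j : Fin (k + 2), X (z i) = X (z j) → ¬ i < j := by
      intro i j hij hlt
      have : ((i : ℕ) : ℝ) + 1 ≤ (j : ℕ) := by exact_mod_cast hlt
      have h1 := (hz i).2
      have h2 := (hz j).1
      rw [hij] at h1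
      nlinarith
    rcases lt_or_gt_of_ne hne with h1 | h1
    · exact key _ _ hll h1
    · exact key _ _ hll.symm h1
  have hcard := Finset.card_le_card_of_injOn (s := (univ : Finset (Fin (k + 2)))) _
    (fun l _ => hmem l) hinj.injOn
  rw [Finset.card_univ, Fintype.card_fin] at hcard
  rw [valueCount] at h
  omega

lemma meanDist_antitone {Ω : Type} [Fintype Ω] {P : Ω → ℝ} {X : ℕ → Ω → ℝ}
    (hX : ∀ i q, meanDist P (X (i + 1)) q ≤ meanDist P (X i) q) {s t : ℕ} (hst : s ≤ t) (q : ℝ) :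
    meanDist P (X t) q ≤ meanDist P (X s) q :=
  antitone_nat_of_succ_le (f := fun i => meanDist P (X i) q) (fun i => hX i q) hst

/-- Choice of thresholds: a sequence of random variables with decreasing mean distances and
boundedly many values admits thresholds that stay away from the values, and whose moves
sweep a total mass controlled by the decrease of finitely many mean distances. -/
lemma exists_thresholds (k : ℕ) : ∀ α β : ℝ, α < β → ∃ δ > 0, ∃ Q : Finset ℝ, ∃ C ≥ (0 : ℝ),
    ∀ (Ω : Type) [Fintype Ω] (P : Ω → ℝ) (X : ℕ → Ω → ℝ), (∀ ω, 0 ≤ P ω) →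
    (∀ i q, meanDist P (X (i + 1)) q ≤ meanDist P (X i) q) → ∀ s t : ℕ, s ≤ t →
    (∀ i, s ≤ i → i ≤ t → valueCount (X i) α β ≤ k) →
    ∃ θ : ℕ → ℝ, (∀ i, s ≤ i → i ≤ t → θ i ∈ Q ∧ θ i ∈ Set.Ioo α β ∧ ∀ ω, δ ≤ |X i ω - θ i|) ∧
      ∑ i ∈ Finset.Ico s t, mass P (fun ω => X (i + 1) ω ∈ Set.uIcc (θ i) (θ (i + 1))) ≤
        C * ∑ q ∈ Q, (meanDist P (X s) q - meanDist P (X t) q) := by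
  induction k with
  | zero =>
    intro α β hαβ
    refine ⟨(β - α) / 2, by linarith, {(α + β) / 2}, 0, le_rfl, ?_⟩
    intro Ω _ P X hP hX s t hst hcount
    have gap : ∀ i, s ≤ i → i ≤ t → ∀ ω, (β - α) / 2 ≤ |X i ω - (α + β) / 2| := by
      intro i hi hi' ω
      have := not_mem_of_valueCount_eq_zero (hcount i hi hi') ω
      by_contra! hlt
      rw [abs_lt] at hlt
      exact this ⟨by linarith [hlt.1], by linarith [hlt.2]⟩
    refine ⟨fun _ => (α + β) / 2, fun i hi hi' => ⟨by simp, ⟨by linarith, by linarith⟩,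
      gap i hi hi'⟩, ?_⟩
    rw [zero_mul]
    refine (Finset.sum_eq_zero fun i hi => ?_).le
    rw [Finset.mem_Ico] at hi
    refine Finset.sum_eq_zero fun ω _ => ?_
    rw [propInd_false, mul_zero]
    simp only [Set.uIcc_self, Set.mem_singleton_iff]
    intro h
    have := gap (i + 1) (by omega) (by omega) ω
    rw [h, sub_self, abs_zero] at this
    linarith
  | succ k ih =>
    intro α β hαβ
    obtain ⟨w, hw, hβ⟩ : ∃ w > 0, β = α + (k + 2) * (3 * w) := by
      refine ⟨(β - α) / (3 * (k + 2)), div_pos (by linarith) (by positivity), ?_⟩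
      field_simp; ring
    set a : Fin (k + 2) → ℝ := fun l => α + l * (3 * w) with ha
    choose δ hδ Q C hC H using fun l => ih (a l + w) (a l + 2 * w) (by linarith)
    obtain ⟨l₀, -, hl₀⟩ := Finset.exists_min_image univ δ univ_nonempty
    set Q' : Finset ℝ := univ.biUnion fun l => insert (a l + w) (insert (a l + 2 * w) (Q l))
      with hQ'
    have hQsub : ∀ l, Q l ⊆ Q' := fun l q hq =>
      Finset.mem_biUnion.2 ⟨l, mem_univ _, by simp [hq]⟩
    refine ⟨δ l₀, hδ l₀, Q', ∑ l, C l + 1 / (2 * w),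
      add_nonneg (Finset.sum_nonneg fun l _ => hC l) (by positivity), ?_⟩
    intro Ω _ P X hP hX s t
    have sumQ : ∀ (R : Finset ℝ), R ⊆ Q' → ∀ s t, s ≤ t →
        ∑ q ∈ R, (meanDist P (X s) q - meanDist P (X t) q) ≤
          ∑ q ∈ Q', (meanDist P (X s) q - meanDist P (X t) q) := fun R hR s t hst =>
      Finset.sum_le_sum_of_subset_of_nonneg hR fun q _ _ =>
        sub_nonneg.2 (meanDist_antitone hX hst q)
    have sumQ0 : ∀ s t, s ≤ t →
        0 ≤ ∑ q ∈ Q', (meanDist P (X s) q - meanDist P (X t) q) := fun s t hst =>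
      Finset.sum_nonneg fun q _ => sub_nonneg.2 (meanDist_antitone hX hst q)
    have run_cost : ∀ l s t t', s ≤ t → t ≤ t' →
        C l * ∑ q ∈ Q l, (meanDist P (X s) q - meanDist P (X t) q) ≤
          (∑ l, C l) * ∑ q ∈ Q', (meanDist P (X s) q - meanDist P (X t') q) := by
      intro l s t t' hst htt
      refine mul_le_mul (Finset.single_le_sum (fun l _ => hC l) (mem_univ l)) ?_
        (Finset.sum_nonneg fun q _ => sub_nonneg.2 (meanDist_antitone hX hst q))
        (Finset.sum_nonneg fun l _ => hC l)
      refine (Finset.sum_le_sum fun q _ => ?_).trans (sumQ _ (hQsub l) s t' (hst.trans htt))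
      linarith [meanDist_antitone hX htt q]
    have hsub : ∀ l : Fin (k + 2), Set.Ioo (a l + w) (a l + 2 * w) ⊆ Set.Ioo α β := by
      intro l z hz
      have h1 : (0 : ℝ) ≤ l * (3 * w) := by positivity
      have h2 : ((l : ℕ) : ℝ) + 1 ≤ k + 2 := by exact_mod_cast l.2
      simp only [ha, Set.mem_Ioo] at hz
      exact ⟨by linarith, by rw [hβ]; nlinarith⟩
    induction hn : t - s using Nat.strong_induction_on generalizing s with
    | _ n IH =>
      intro hst hcount
      obtain ⟨l, hl⟩ := exists_avoided_interval (X := X s) (a := α) (w := 3 * w) (by positivity)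
        (by rw [← hβ]; exact hcount s le_rfl hst)
      have hl' : ∀ ω, X s ω ∉ Set.Ioo (a l) (a l + 3 * w) := hl
      by_cases hall : ∀ i, s ≤ i → i ≤ t → valueCount (X i) (a l + w) (a l + 2 * w) ≤ k
      · obtain ⟨θ, hθ, hcost⟩ := H l Ω P X hP hX s t hst hall
        refine ⟨θ, fun i hi hi' => ?_, ?_⟩
        · obtain ⟨h1, h2, h3⟩ := hθ i hi hi'
          exact ⟨hQsub l h1, hsub l h2, fun ω => (hl₀ l (mem_univ _)).trans (h3 ω)⟩
        · refine hcost.trans ((run_cost l s t t hst le_rfl).trans ?_)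
          exact mul_le_mul_of_nonneg_right (le_add_of_nonneg_right (by positivity)) (sumQ0 s t hst)
      · push Not at hall
        classical
        have hu := Nat.find_spec hall
        have hmin := fun {m} => Nat.find_min (m := m) hall
        set u := Nat.find hall with hudef
        clear_value u
        obtain ⟨hsu, hut, hku⟩ := hu
        have hne : u ≠ s := by
          rintro rfl
          rw [valueCount_eq_zero] at hku
          · omega
          · exact fun ω hω => hl' ω ⟨by linarith [hω.1], by linarith [hω.2]⟩
        obtain ⟨v, rfl⟩ : ∃ v, u = v + 1 := ⟨u - 1, by omega⟩
        obtain ⟨θ₁, hθ₁, hcost₁⟩ := H l Ω P X hP hX s v (by omega) (by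
          intro i hi hi'
          by_contra! hlt
          exact hmin (m := i) (by omega) ⟨hi, by omega, hlt⟩)
        obtain ⟨θ₂, hθ₂, hcost₂⟩ := IH (t - (v + 1)) (by omega) (v + 1) rfl hut
          (fun i hi hi' => hcount i (by omega) hi')
        refine ⟨fun i => if i ≤ v then θ₁ i else θ₂ i, fun i hi hi' => ?_, ?_⟩
        · by_cases hiv : i ≤ v
          · simp only [hiv, if_true]
            obtain ⟨h1, h2, h3⟩ := hθ₁ i hi hiv
            exact ⟨hQsub l h1, hsub l h2, fun ω => (hl₀ l (mem_univ _)).trans (h3 ω)⟩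
          · simp only [hiv, if_false]
            exact hθ₂ i (by omega) hi'
        · have hjump : mass P (fun ω => X (v + 1) ω ∈ Set.uIcc (θ₁ v) (θ₂ (v + 1))) ≤
              1 / (2 * w) * ∑ q ∈ Q', (meanDist P (X s) q - meanDist P (X (v + 1)) q) := by
            have hle : mass P (fun ω => X (v + 1) ω ∈ Set.uIcc (θ₁ v) (θ₂ (v + 1))) ≤
                mass P (fun ω => X (v + 1) ω ∈ Set.Icc (a l + w) (a l + 2 * w)) := by
              refine mass_mono hP fun ω hω => ?_
              refine Set.Ioo_subset_Icc_self (mem_of_valueCount_le (hsub l)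
                ((hcount (v + 1) hsu hut).trans hku) ?_)
              exact Set.OrdConnected.uIcc_subset Set.ordConnected_Ioo
                (hsub l (hθ₁ v (by omega) le_rfl).2.1) (hθ₂ (v + 1) le_rfl hut).2.1 hω
            have hmid := mass_middle_third_le hP hw hl'
              (fun q => meanDist_antitone hX hsu q)
            have hpair := sumQ {a l + w, a l + 2 * w} (by
              intro q hq
              refine Finset.mem_biUnion.2 ⟨l, mem_univ _, ?_⟩
              simp only [Finset.mem_insert, Finset.mem_singleton] at hq ⊢
              tauto) s (v + 1) hsu
            rw [Finset.sum_pair (by linarith)] at hpair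
            rw [div_mul_eq_mul_div, one_mul, le_div_iff₀ (by positivity)]
            nlinarith
          have hsplit : ∀ F : ℕ → ℝ, ∑ i ∈ Finset.Ico s t, F i =
              ∑ i ∈ Finset.Ico s v, F i + F v + ∑ i ∈ Finset.Ico (v + 1) t, F i := by
            intro F
            rw [← Finset.sum_Ico_consecutive F (by omega : s ≤ v + 1) hut,
              Finset.sum_Ico_succ_top (by omega)]
          rw [hsplit]
          have e1 : ∑ i ∈ Finset.Ico s v, mass P (fun ω => X (i + 1) ω ∈
              Set.uIcc (if i ≤ v then θ₁ i else θ₂ i)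
                (if i + 1 ≤ v then θ₁ (i + 1) else θ₂ (i + 1))) =
              ∑ i ∈ Finset.Ico s v, mass P (fun ω => X (i + 1) ω ∈
                Set.uIcc (θ₁ i) (θ₁ (i + 1))) := by
            refine Finset.sum_congr rfl fun i hi => ?_
            rw [Finset.mem_Ico] at hi
            rw [if_pos (by omega), if_pos (by omega)]
          have e2 : ∑ i ∈ Finset.Ico (v + 1) t, mass P (fun ω => X (i + 1) ω ∈
              Set.uIcc (if i ≤ v then θ₁ i else θ₂ i)
                (if i + 1 ≤ v then θ₁ (i + 1) else θ₂ (i + 1))) =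
              ∑ i ∈ Finset.Ico (v + 1) t, mass P (fun ω => X (i + 1) ω ∈
                Set.uIcc (θ₂ i) (θ₂ (i + 1))) := by
            refine Finset.sum_congr rfl fun i hi => ?_
            rw [Finset.mem_Ico] at hi
            rw [if_neg (by omega), if_neg (by omega)]
          have e3 : mass P (fun ω => X (v + 1) ω ∈
              Set.uIcc (if v ≤ v then θ₁ v else θ₂ v)
                (if v + 1 ≤ v then θ₁ (v + 1) else θ₂ (v + 1))) =
              mass P (fun ω => X (v + 1) ω ∈ Set.uIcc (θ₁ v) (θ₂ (v + 1))) := by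
            rw [if_pos le_rfl, if_neg (by omega)]
          refine (add_le_add (add_le_add (e1.le.trans hcost₁) (e3.le.trans hjump))
            (e2.le.trans hcost₂)).trans ?_
          have hrun := run_cost l s v (v + 1) (by omega) (by omega)
          have htel : ∑ q ∈ Q', (meanDist P (X s) q - meanDist P (X t) q) =
              ∑ q ∈ Q', (meanDist P (X s) q - meanDist P (X (v + 1)) q) +
              ∑ q ∈ Q', (meanDist P (X (v + 1)) q - meanDist P (X t) q) := by
            rw [← Finset.sum_add_distrib]
            exact Finset.sum_congr rfl fun q _ => by ring
          rw [htel, mul_add]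
          linarith

/-- If `Y` is a conditional expectation of `X`, then passing from `X` to `Y` decreases the mean
distance to `q` by at least the mass of the downward crossings of `q`. -/
lemma crossing_le {Ω : Type} [Fintype Ω] {P X Y : Ω → ℝ} (hP : ∀ ω, 0 ≤ P ω)
    (hXY : ∀ ψ : ℝ → ℝ, ∑ ω, P ω * (ψ (Y ω) * X ω) = ∑ ω, P ω * (ψ (Y ω) * Y ω))
    {q δ : ℝ} (hδ : ∀ ω, δ ≤ |X ω - q|) :
    meanDist P Y q + 2 * δ * mass P (fun ω => q < X ω ∧ Y ω ≤ q) ≤ meanDist P X q := by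
  set σ : ℝ → ℝ := fun z => if q < z then 1 else -1 with hσ
  have h1 : meanDist P Y q = ∑ ω, P ω * (σ (Y ω) * (X ω - q)) := by
    have h2 : meanDist P Y q = ∑ ω, P ω * (σ (Y ω) * (Y ω - q)) := by
      refine Finset.sum_congr rfl fun ω _ => ?_
      simp only [hσ]
      split_ifs with h
      · rw [abs_of_nonneg (by linarith)]; ring
      · rw [abs_of_nonpos (by linarith)]; ring
    rw [h2]
    simp only [mul_sub, Finset.sum_sub_distrib]
    rw [hXY]
  rw [h1, mass, Finset.mul_sum, ← Finset.sum_add_distrib, meanDist]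
  refine Finset.sum_le_sum fun ω _ => ?_
  have key : σ (Y ω) * (X ω - q) + 2 * δ * propInd (q < X ω ∧ Y ω ≤ q) ≤ |X ω - q| := by
    by_cases h : q < X ω ∧ Y ω ≤ q
    · rw [propInd_true h]
      have := hδ ω
      rw [abs_of_pos (by linarith [h.1])] at this ⊢
      simp only [hσ, if_neg (not_lt.2 h.2)]
      linarith
    · rw [propInd_false h, mul_zero, add_zero]
      simp only [hσ]
      split_ifs
      · rw [one_mul]; exact le_abs_self _
      · rw [neg_one_mul]; exact neg_le_abs _
  have := mul_le_mul_of_nonneg_left key (hP ω)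
  linarith

/-- A reverse martingale with at most `K` values at each time has thresholds in `(1/2, 1)` whose
downward crossings have total mass controlled by the distance of the two end variables. -/
lemma exists_cut_thresholds (K : ℕ) : ∃ C ≥ (0 : ℝ), ∀ (Ω : Type) [Fintype Ω] (P : Ω → ℝ)
    (X : ℕ → Ω → ℝ) (n : ℕ), (∀ ω, 0 ≤ P ω) →
    (∀ i, ∀ ψ : ℝ → ℝ, ∑ ω, P ω * (ψ (X (i + 1) ω) * X i ω) =
      ∑ ω, P ω * (ψ (X (i + 1) ω) * X (i + 1) ω)) →
    (∀ i, (univ.image (X i)).card ≤ K) →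
    ∃ θ : ℕ → ℝ, (∀ i, i ≤ n → θ i ∈ Set.Ioo (1 / 2 : ℝ) 1) ∧
      ∑ i ∈ Finset.range n, mass P (fun ω => θ i < X i ω ∧ X (i + 1) ω ≤ θ (i + 1)) ≤
        C * ∑ ω, P ω * |X 0 ω - X n ω| := by
  obtain ⟨δ, hδ, Q, C, hC, H⟩ := exists_thresholds K (1 / 2) 1 (by norm_num)
  refine ⟨(1 / (2 * δ) + C) * Q.card, by positivity, ?_⟩
  intro Ω _ P X n hP hX hK
  have hmono : ∀ i q, meanDist P (X (i + 1)) q ≤ meanDist P (X i) q := by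
    intro i q
    simpa using crossing_le (q := q) (δ := 0) hP (hX i) (fun ω => abs_nonneg _)
  obtain ⟨θ, hθ, hcost⟩ := H Ω P X hP hmono 0 n n.zero_le (by
    intro i _ _
    classical
    refine le_trans ?_ (hK i)
    rw [valueCount]
    convert Finset.card_filter_le (univ.image (X i)) _)
  refine ⟨θ, fun i hi => (hθ i i.zero_le hi).2.1, ?_⟩
  rw [Nat.Ico_zero_eq_range] at hcost
  have hcross : ∀ i ∈ Finset.range n, mass P (fun ω => θ i < X i ω ∧ X (i + 1) ω ≤ θ (i + 1)) ≤
      1 / (2 * δ) * ∑ q ∈ Q, (meanDist P (X i) q - meanDist P (X (i + 1)) q) +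
        mass P (fun ω => X (i + 1) ω ∈ Set.uIcc (θ i) (θ (i + 1))) := by
    intro i hi
    obtain ⟨h1, -, h3⟩ := hθ i i.zero_le (Finset.mem_range.1 hi).le
    have hc := crossing_le hP (hX i) h3
    have hs := Finset.single_le_sum
      (f := fun q => meanDist P (X i) q - meanDist P (X (i + 1)) q)
      (fun q _ => sub_nonneg.2 (hmono i q)) h1
    have hm : mass P (fun ω => θ i < X i ω ∧ X (i + 1) ω ≤ θ i) ≤
        1 / (2 * δ) * ∑ q ∈ Q, (meanDist P (X i) q - meanDist P (X (i + 1)) q) := by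
      rw [div_mul_eq_mul_div, one_mul, le_div_iff₀ (by positivity)]
      linarith
    refine le_trans ?_ (add_le_add_left hm _)
    rw [mass, mass, mass, ← Finset.sum_add_distrib]
    refine Finset.sum_le_sum fun ω _ => ?_
    rw [← mul_add]
    refine mul_le_mul_of_nonneg_left ?_ (hP ω)
    by_cases h : θ i < X i ω ∧ X (i + 1) ω ≤ θ (i + 1)
    · by_cases h' : X (i + 1) ω ≤ θ i
      · rw [propInd_true h, propInd_true (p := θ i < X i ω ∧ X (i + 1) ω ≤ θ i) ⟨h.1, h'⟩]
        linarith [propInd_nonneg (X (i + 1) ω ∈ Set.uIcc (θ i) (θ (i + 1)))]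
      · rw [propInd_true h, propInd_true (p := X (i + 1) ω ∈ Set.uIcc (θ i) (θ (i + 1)))
          (Set.mem_uIcc.2 (Or.inl ⟨(not_le.1 h').le, h.2⟩))]
        linarith [propInd_nonneg (θ i < X i ω ∧ X (i + 1) ω ≤ θ i)]
    · rw [propInd_false h]
      exact add_nonneg (propInd_nonneg _) (propInd_nonneg _)
  refine (Finset.sum_le_sum hcross).trans ?_
  have htel : ∑ i ∈ Finset.range n, ∑ q ∈ Q, (meanDist P (X i) q - meanDist P (X (i + 1)) q) =
      ∑ q ∈ Q, (meanDist P (X 0) q - meanDist P (X n) q) := by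
    rw [Finset.sum_comm]
    exact Finset.sum_congr rfl fun q _ => Finset.sum_range_sub' (fun i => meanDist P (X i) q) n
  have hend : ∑ q ∈ Q, (meanDist P (X 0) q - meanDist P (X n) q) ≤
      Q.card * ∑ ω, P ω * |X 0 ω - X n ω| := by
    rw [← nsmul_eq_mul]
    refine Finset.sum_le_card_nsmul _ _ _ fun q _ => ?_
    rw [meanDist, meanDist, ← Finset.sum_sub_distrib]
    refine Finset.sum_le_sum fun ω _ => ?_
    rw [← mul_sub]
    refine mul_le_mul_of_nonneg_left ?_ (hP ω)
    have := abs_sub_abs_le_abs_sub (X 0 ω - q) (X n ω - q)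
    rwa [sub_sub_sub_cancel_right] at this
  rw [Finset.sum_add_distrib, ← Finset.mul_sum, htel]
  have hc : 0 ≤ 1 / (2 * δ) + C := by positivity
  calc _ ≤ (1 / (2 * δ) + C) * ∑ q ∈ Q, (meanDist P (X 0) q - meanDist P (X n) q) := by
        linarith
    _ ≤ _ := by
        rw [mul_assoc]
        exact mul_le_mul_of_nonneg_left hend hc

/-- Two assignments agree on `D`. -/
def AgreeOn {V : Type} (D : Finset V) (f g : V → Bool) : Prop := ∀ v ∈ D, f v = g v

lemma AgreeOn.symm {V : Type} {D : Finset V} {f g : V → Bool} (h : AgreeOn D f g) :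
    AgreeOn D g f := fun v hv => (h v hv).symm

lemma AgreeOn.trans {V : Type} {D : Finset V} {f g k : V → Bool} (h : AgreeOn D f g)
    (h' : AgreeOn D g k) : AgreeOn D f k := fun v hv => (h v hv).trans (h' v hv)

lemma AgreeOn.refl {V : Type} (D : Finset V) (f : V → Bool) : AgreeOn D f f := fun _ _ => rfl

lemma AgreeOn.mono {V : Type} {D D' : Finset V} {f g : V → Bool} (h : AgreeOn D f g)
    (hD : D' ⊆ D) : AgreeOn D' f g := fun v hv => h v (hD hv)

/-- The function `φ` of an assignment depends only on the coordinates in `D`. -/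
def OnlyDependsOn {V : Type} {α : Sort*} (φ : (V → Bool) → α) (D : Finset V) : Prop :=
  ∀ f g, AgreeOn D f g → φ f = φ g

lemma OnlyDependsOn.mono {V : Type} {α : Sort*} {φ : (V → Bool) → α} {D D' : Finset V}
    (h : OnlyDependsOn φ D) (hD : D ⊆ D') : OnlyDependsOn φ D' :=
  fun f g hfg => h f g (hfg.mono hD)

lemma OnlyDependsOn.comp {V : Type} {α β : Sort*} {φ : (V → Bool) → α} {D : Finset V}
    (h : OnlyDependsOn φ D) (F : α → β) : OnlyDependsOn (fun f => F (φ f)) D :=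
  fun f g hfg => congrArg F (h f g hfg)

lemma OnlyDependsOn.comp₂ {V : Type} {α β γ : Sort*} {φ : (V → Bool) → α} {ψ : (V → Bool) → β}
    {D : Finset V} (h : OnlyDependsOn φ D) (h' : OnlyDependsOn ψ D) (F : α → β → γ) :
    OnlyDependsOn (fun f => F (φ f) (ψ f)) D :=
  fun f g hfg => by simp only [h f g hfg, h' f g hfg]

lemma onlyDependsOn_eval {V : Type} {x : V} {D : Finset V} (hx : x ∈ D) :
    OnlyDependsOn (fun f : V → Bool => f x) D := fun _ _ hfg => hfg x hx

lemma propInd_agreeOn_congr {V : Type} {D : Finset V} {f g k : V → Bool} (h : AgreeOn D f g) :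
    propInd (AgreeOn D f k) = propInd (AgreeOn D g k) := by
  by_cases h' : AgreeOn D f k
  · rw [propInd_true h', propInd_true (h.symm.trans h')]
  · rw [propInd_false h', propInd_false fun h2 => h' (h.trans h2)]

lemma propInd_agreeOn_comm {V : Type} (D : Finset V) (f k : V → Bool) :
    propInd (AgreeOn D f k) = propInd (AgreeOn D k f) := by
  congr 1
  exact propext ⟨AgreeOn.symm, AgreeOn.symm⟩

/-- The assignment equal to `f` on `X` and to `g` off `X`. -/
def splice {V : Type} [DecidableEq V] (X : Finset V) (f g : V → Bool) : V → Bool :=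
  fun v => if v ∈ X then f v else g v

lemma splice_splice {V : Type} [DecidableEq V] (X : Finset V) (f g : V → Bool) :
    splice X (splice X f g) (splice X g f) = f := by
  funext v
  by_cases h : v ∈ X <;> simp [splice, h]

lemma agreeOn_splice {V : Type} [DecidableEq V] {X S : Finset V} {f k : V → Bool}
    (h : AgreeOn S f k) :
    AgreeOn S (splice X k f) f := by
  intro v hv
  by_cases hX : v ∈ X <;> simp [splice, hX, h v hv]

section Marginals

variable {V : Type} [Fintype V] [DecidableEq V]

/-- The marginal weight of the restriction of `f` to `D`. -/
noncomputable def marg (P : (V → Bool) → ℝ) (D : Finset V) (f : V → Bool) : ℝ :=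
  ∑ k, P k * propInd (AgreeOn D f k)

lemma marg_nonneg {P : (V → Bool) → ℝ} (hP : ∀ f, 0 ≤ P f) (D : Finset V) (f : V → Bool) :
    0 ≤ marg P D f := Finset.sum_nonneg fun k _ => mul_nonneg (hP k) (propInd_nonneg _)

lemma le_marg {P : (V → Bool) → ℝ} (hP : ∀ f, 0 ≤ P f) (D : Finset V) (f : V → Bool) :
    P f ≤ marg P D f := by
  have := Finset.single_le_sum (f := fun k => P k * propInd (AgreeOn D f k))
    (fun k _ => mul_nonneg (hP k) (propInd_nonneg _)) (mem_univ f)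
  simp only [propInd_true (AgreeOn.refl D f), mul_one] at this
  exact this

lemma onlyDependsOn_marg (P : (V → Bool) → ℝ) (D : Finset V) : OnlyDependsOn (marg P D) D :=
  fun f g hfg => Finset.sum_congr rfl fun k _ => by rw [propInd_agreeOn_congr hfg]

/-- The conditional expectation of `a` given the coordinates in `D`. -/
noncomputable def condMean (P : (V → Bool) → ℝ) (D : Finset V) (a : (V → Bool) → ℝ)
    (f : V → Bool) : ℝ :=
  (∑ k, P k * propInd (AgreeOn D f k) * a k) / marg P D f

lemma onlyDependsOn_condMean (P : (V → Bool) → ℝ) (D : Finset V) (a : (V → Bool) → ℝ) :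
    OnlyDependsOn (condMean P D a) D := by
  intro f g hfg
  rw [condMean, condMean, onlyDependsOn_marg P D f g hfg]
  congr 1
  exact Finset.sum_congr rfl fun k _ => by rw [propInd_agreeOn_congr hfg]

lemma condMean_nonneg {P : (V → Bool) → ℝ} (hP : ∀ f, 0 ≤ P f) (D : Finset V)
    {a : (V → Bool) → ℝ} (ha : ∀ f, 0 ≤ a f) (f : V → Bool) : 0 ≤ condMean P D a f :=
  div_nonneg (Finset.sum_nonneg fun k _ =>
    mul_nonneg (mul_nonneg (hP k) (propInd_nonneg _)) (ha k)) (marg_nonneg hP D f)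

lemma mul_marg_div_marg {P : (V → Bool) → ℝ} (hP : ∀ f, 0 ≤ P f) (D : Finset V)
    (f : V → Bool) : P f * (marg P D f / marg P D f) = P f := by
  by_cases h : marg P D f = 0
  · have : P f = 0 := le_antisymm (h ▸ le_marg hP D f) (hP f)
    rw [this, zero_mul]
  · rw [div_self h, mul_one]

/-- On the support of `P`, conditioning does not change a function of the given coordinates. -/
lemma mul_condMean_eq {P : (V → Bool) → ℝ} (hP : ∀ f, 0 ≤ P f) {D : Finset V}
    {a : (V → Bool) → ℝ} (ha : OnlyDependsOn a D) (f : V → Bool) :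
    P f * condMean P D a f = P f * a f := by
  have : ∑ k, P k * propInd (AgreeOn D f k) * a k = a f * marg P D f := by
    rw [marg, Finset.mul_sum]
    refine Finset.sum_congr rfl fun k _ => ?_
    by_cases h : AgreeOn D f k
    · rw [ha f k h]; ring
    · rw [propInd_false h]; ring
  rw [condMean, this]
  conv_rhs => rw [← mul_marg_div_marg hP D f]
  ring

lemma sum_mul_condMean {P : (V → Bool) → ℝ} (hP : ∀ f, 0 ≤ P f) {D : Finset V}
    {φ : (V → Bool) → ℝ} (hφ : OnlyDependsOn φ D) (a : (V → Bool) → ℝ) :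
    ∑ f, P f * (φ f * condMean P D a f) = ∑ f, P f * (φ f * a f) := by
  simp only [condMean, Finset.sum_div, Finset.mul_sum]
  rw [Finset.sum_comm]
  refine Finset.sum_congr rfl fun k _ => ?_
  calc _ = ∑ f, (P k * a k * φ k / marg P D k) * (P f * propInd (AgreeOn D k f)) := by
        refine Finset.sum_congr rfl fun f _ => ?_
        by_cases h : AgreeOn D f k
        · rw [hφ f k h, onlyDependsOn_marg P D f k h, propInd_agreeOn_comm D k f]; ring
        · rw [propInd_agreeOn_comm D k f, propInd_false h]; ring
    _ = P k * (marg P D k / marg P D k) * (φ k * a k) := by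
        rw [← Finset.mul_sum]; change _ * marg P D k = _; ring
    _ = _ := by rw [mul_marg_div_marg hP]

/-- Markov property: if exchanging the `X`-parts of two assignments that agree on `S` preserves
the product weight, then conditioning on `S` is as good as conditioning on any set meeting `X`
inside `S`, for a function of the coordinates in `X`. -/
lemma sum_mul_condMean_of_splice {P : (V → Bool) → ℝ} (hP : ∀ f, 0 ≤ P f) {X S D : Finset V}
    (hswap : ∀ f k, AgreeOn S f k → P f * P k = P (splice X k f) * P (splice X f k))
    {a φ : (V → Bool) → ℝ} (ha : OnlyDependsOn a X) (hφ : OnlyDependsOn φ D)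
    (hD : D ∩ X ⊆ S) :
    ∑ f, P f * (φ f * condMean P S a f) = ∑ f, P f * (φ f * a f) := by
  have h1 : ∑ f, P f * (φ f * condMean P S a f) =
      ∑ p : (V → Bool) × (V → Bool),
        P p.1 * P p.2 * propInd (AgreeOn S p.1 p.2) * φ p.1 / marg P S p.1 * a p.2 := by
    rw [Fintype.sum_prod_type]
    refine Finset.sum_congr rfl fun f _ => ?_
    simp only [condMean, Finset.sum_div, Finset.mul_sum]
    exact Finset.sum_congr rfl fun k _ => by ring
  have h2 : ∑ f, P f * (φ f * a f) =
      ∑ p : (V → Bool) × (V → Bool),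
        P p.1 * P p.2 * propInd (AgreeOn S p.1 p.2) * φ p.1 / marg P S p.1 * a p.1 := by
    rw [Fintype.sum_prod_type]
    refine Finset.sum_congr rfl fun f _ => ?_
    calc _ = P f * (marg P S f / marg P S f) * (φ f * a f) := by rw [mul_marg_div_marg hP]
      _ = (P f * φ f / marg P S f * a f) * marg P S f := by ring
      _ = _ := by
        have hm : ∀ c, c * marg P S f = ∑ k, c * (P k * propInd (AgreeOn S f k)) :=
          fun c => Finset.mul_sum _ _ _
        rw [hm]
        exact Finset.sum_congr rfl fun k _ => by ring
  rw [h1, h2]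
  let e : (V → Bool) × (V → Bool) ≃ (V → Bool) × (V → Bool) :=
    { toFun := fun p => (splice X p.2 p.1, splice X p.1 p.2)
      invFun := fun p => (splice X p.2 p.1, splice X p.1 p.2)
      left_inv := fun p => by simp only [splice_splice]
      right_inv := fun p => by simp only [splice_splice] }
  refine Fintype.sum_equiv e _ _ ?_
  rintro ⟨f, k⟩
  simp only [e, Equiv.coe_fn_mk]
  by_cases h : AgreeOn S f k
  · have hf := agreeOn_splice (X := X) h
    have hk := agreeOn_splice (X := X) h.symm
    rw [hswap f k h, propInd_true h, propInd_true (hf.trans (h.trans hk.symm)),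
      onlyDependsOn_marg P S _ _ hf, hφ (splice X k f) f, ha (splice X k f) k]
    · intro v hv; simp [splice, hv]
    · intro v hv
      by_cases hX : v ∈ X
      · exact hf v (hD (Finset.mem_inter.2 ⟨hv, hX⟩))
      · simp [splice, hX]
  · have h' : ¬ AgreeOn S (splice X k f) (splice X f k) := by
      intro h'
      refine h fun v hv => ?_
      have := h' v hv
      by_cases hX : v ∈ X <;> simp [splice, hX] at this
      · exact this.symm
      · exact this
    rw [propInd_false h, propInd_false h']; ring

lemma card_image_le_of_onlyDependsOn {φ : (V → Bool) → ℝ} {D : Finset V}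
    (hφ : OnlyDependsOn φ D) : (univ.image φ).card ≤ 2 ^ D.card := by
  classical
  have hsub : univ.image φ ⊆ univ.image fun u : D → Bool =>
      φ fun v => if h : v ∈ D then u ⟨v, h⟩ else false := by
    intro z hz
    obtain ⟨f, -, rfl⟩ := Finset.mem_image.1 hz
    refine Finset.mem_image.2 ⟨fun v => f v, mem_univ _, hφ _ _ fun v hv => ?_⟩
    simp [hv]
  refine (Finset.card_le_card hsub).trans (Finset.card_image_le.trans ?_)
  simp

end Marginals

lemma mass_and_add_mass_and_not {Ω : Type} [Fintype Ω] (P : Ω → ℝ) (p q : Ω → Prop) :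
    mass P p = mass P (fun ω => p ω ∧ q ω) + mass P (fun ω => p ω ∧ ¬ q ω) := by
  rw [mass, mass, mass, ← Finset.sum_add_distrib]
  refine Finset.sum_congr rfl fun ω _ => ?_
  by_cases hp : p ω <;> by_cases hq : q ω <;> simp [propInd, hp, hq]

lemma abs_propInd_sub_le (b c d : Bool) :
    |propInd (c = b) - propInd (d = b)| ≤ propInd (c ≠ d) := by
  cases b <;> cases c <;> cases d <;> simp [propInd]

lemma propInd_ne_mul_le (b c d : Bool) :
    propInd (d ≠ b) * propInd (c = b) ≤ propInd (c ≠ d) := by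
  cases b <;> cases c <;> cases d <;> simp [propInd]

/-- A family of local distributions along a Markov chain of separators from `x` to `y` cannot
separate `x` and `y` much more often than the global distribution does. -/
lemma exists_local_le_global (r : ℕ) : ∃ C ≥ (0 : ℝ), ∀ (V : Type) [Fintype V] [DecidableEq V]
    (P : (V → Bool) → ℝ) (D : ℕ → Finset V) (ν : ℕ → (V → Bool) → ℝ) (n : ℕ) (x y : V)
    (b : Bool),
    (∀ f, 0 ≤ P f) → (∀ i f, 0 ≤ ν i f) → D 0 = {x} → D n = {y} → (∀ i, (D i).card ≤ r + 1) →
    (∀ i, ∀ φ : (V → Bool) → ℝ, OnlyDependsOn φ (D i ∪ D (i + 1)) →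
      ∑ f, ν i f * φ f = ∑ f, P f * φ f) →
    (∀ i, ∀ φ : (V → Bool) → ℝ, OnlyDependsOn φ (D (i + 1) ∪ {x, y}) →
      ∑ f, ν i f * φ f = ∑ f, ν (i + 1) f * φ f) →
    (∀ i, ∀ φ : (V → Bool) → ℝ, OnlyDependsOn φ (D (i + 1)) →
      ∑ f, P f * (φ f * condMean P (D i) (fun k => propInd (k x = b)) f) =
        ∑ f, P f * (φ f * propInd (f x = b))) →
    mass (ν 0) (fun f => f x = b ∧ f y ≠ b) ≤ C * mass P (fun f => f x ≠ f y) := by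
  obtain ⟨C, hC, H⟩ := exists_cut_thresholds (2 ^ (r + 1))
  refine ⟨C * 2 + 2, by positivity, ?_⟩
  intro V _ _ P D ν n x y b hP hν h0 hn hcard hloc hcons hmark
  set h : ℕ → (V → Bool) → ℝ := fun i => condMean P (D i) (fun k => propInd (k x = b)) with hh
  have hdep : ∀ i, OnlyDependsOn (h i) (D i) := fun i => onlyDependsOn_condMean _ _ _
  obtain ⟨θ, hθ, hcost⟩ := H (V → Bool) P h n hP
    (fun i ψ => by
      have hψ : OnlyDependsOn (fun f => ψ (h (i + 1) f)) (D (i + 1)) := (hdep (i + 1)).comp ψ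
      rw [hmark i _ hψ, sum_mul_condMean hP hψ])
    (fun i => (card_image_le_of_onlyDependsOn (hdep i)).trans
      (Nat.pow_le_pow_right (by norm_num) (hcard i)))
  have hx : OnlyDependsOn (fun f : V → Bool => f x) {x} := onlyDependsOn_eval (by simp)
  have hy : OnlyDependsOn (fun f : V → Bool => f y) {y} := onlyDependsOn_eval (by simp)
  have hh0 : ∀ f, P f * h 0 f = P f * propInd (f x = b) := fun f =>
    mul_condMean_eq hP (by rw [h0]; exact hx.comp fun z => propInd (z = b)) f
  -- the end variables are close in mean
  have hend : ∑ f, P f * |h 0 f - h n f| ≤ 2 * mass P (fun f => f x ≠ f y) := by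
    have hxy : ∀ f : V → Bool, |propInd (f x = b) - propInd (f y = b)| ≤ propInd (f x ≠ f y) :=
      fun f => abs_propInd_sub_le b _ _
    set σ : (V → Bool) → ℝ := fun f => if h n f < propInd (f y = b) then 1 else -1 with hσ
    have hσd : OnlyDependsOn σ (D n) := by
      refine (hdep n).comp₂ (ψ := fun f => f y) ?_ fun z c => if z < propInd (c = b) then 1 else -1
      rw [hn]; exact hy
    have hn' := sum_mul_condMean hP hσd (fun k => propInd (k x = b))
    have h1 : ∑ f, P f * |propInd (f y = b) - h n f| ≤ mass P (fun f => f x ≠ f y) := by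
      have e : ∑ f, P f * |propInd (f y = b) - h n f| =
          ∑ f, P f * (σ f * (propInd (f y = b) - propInd (f x = b))) := by
        have e' : ∑ f, P f * |propInd (f y = b) - h n f| =
          ∑ f, P f * (σ f * (propInd (f y = b) - h n f)) := by
          refine Finset.sum_congr rfl fun f _ => ?_
          simp only [hσ]
          split_ifs with hlt
          · rw [abs_of_pos (by linarith), one_mul]
          · rw [abs_of_nonpos (by linarith), neg_one_mul]
        rw [e']
        simp only [mul_sub, Finset.sum_sub_distrib]
        rw [hn']
      rw [e]
      refine Finset.sum_le_sum fun f _ => mul_le_mul_of_nonneg_left ?_ (hP f)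
      refine le_trans ?_ (hxy f)
      simp only [hσ]
      split_ifs
      · rw [one_mul, abs_sub_comm]; exact le_abs_self _
      · rw [neg_one_mul, neg_sub]; exact le_abs_self _
    have h2 : ∑ f, P f * |propInd (f x = b) - propInd (f y = b)| ≤
        mass P (fun f => f x ≠ f y) :=
      Finset.sum_le_sum fun f _ => mul_le_mul_of_nonneg_left (hxy f) (hP f)
    have h3 : ∑ f, P f * |h 0 f - h n f| ≤
        ∑ f, (P f * |propInd (f x = b) - propInd (f y = b)| +
          P f * |propInd (f y = b) - h n f|) := by
      refine Finset.sum_le_sum fun f _ => ?_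
      have : P f * |h 0 f - h n f| = P f * |propInd (f x = b) - h n f| := by
        have habs : ∀ z, P f * |z| = |P f * z| := fun z => by rw [abs_mul, abs_of_nonneg (hP f)]
        rw [habs, habs, mul_sub, mul_sub, hh0 f]
      rw [this, ← mul_add]
      exact mul_le_mul_of_nonneg_left (abs_sub_le _ _ _) (hP f)
    rw [Finset.sum_add_distrib] at h3
    linarith
  -- transport the cut event along the chain
  have hstep : ∀ i, i ≤ n → mass (ν 0) (fun f => f x = b ∧ f y ≠ b) ≤
      ∑ j ∈ Finset.range i, mass P (fun f => θ j < h j f ∧ h (j + 1) f ≤ θ (j + 1)) +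
        mass (ν i) (fun f => θ i < h i f ∧ f y ≠ b) := by
    intro i
    induction i with
    | zero =>
      intro _
      rw [Finset.sum_range_zero, zero_add]
      have hz : mass (ν 0) (fun f => f x = b ∧ ¬ θ 0 < h 0 f) = 0 := by
        have hd : OnlyDependsOn (fun f => propInd (f x = b ∧ ¬ θ 0 < h 0 f)) (D 0) := by
          refine (hdep 0).comp₂ (ψ := fun f => f x) ?_ fun z c => propInd (c = b ∧ ¬ θ 0 < z)
          rw [h0]; exact hx
        rw [mass, hloc 0 _ (hd.mono Finset.subset_union_left)]
        refine Finset.sum_eq_zero fun f _ => ?_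
        by_cases hf : f x = b ∧ ¬ θ 0 < h 0 f
        · have := hh0 f
          rw [propInd_true hf.1, mul_one] at this
          have hPz : P f * (1 - h 0 f) = 0 := by linarith
          rcases mul_eq_zero.1 hPz with hz | hz
          · rw [hz, zero_mul]
          · have h1 := (hθ 0 n.zero_le).2
            exact absurd (by linarith) hf.2
        · rw [propInd_false hf, mul_zero]
      have h1 := mass_and_add_mass_and_not (ν 0) (fun f => f x = b ∧ f y ≠ b)
        (fun f => θ 0 < h 0 f)
      have h2 := mass_mono (hν 0) (p := fun f => (f x = b ∧ f y ≠ b) ∧ ¬ θ 0 < h 0 f)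
        (q := fun f => f x = b ∧ ¬ θ 0 < h 0 f) fun f hf => ⟨hf.1.1, hf.2⟩
      have h3 := mass_mono (hν 0) (p := fun f => (f x = b ∧ f y ≠ b) ∧ θ 0 < h 0 f)
        (q := fun f => θ 0 < h 0 f ∧ f y ≠ b) fun f hf => ⟨hf.2, hf.1.2⟩
      linarith
    | succ i ih =>
      intro hi
      refine (ih (by omega)).trans ?_
      rw [Finset.sum_range_succ, add_assoc]
      refine add_le_add le_rfl ?_
      have h1 := mass_and_add_mass_and_not (ν i) (fun f => θ i < h i f ∧ f y ≠ b)
        (fun f => θ (i + 1) < h (i + 1) f)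
      have h2 := mass_mono (hν i)
        (p := fun f => (θ i < h i f ∧ f y ≠ b) ∧ ¬ θ (i + 1) < h (i + 1) f)
        (q := fun f => θ i < h i f ∧ h (i + 1) f ≤ θ (i + 1))
        fun f hf => ⟨hf.1.1, not_lt.1 hf.2⟩
      have h3 := mass_mono (hν i)
        (p := fun f => (θ i < h i f ∧ f y ≠ b) ∧ θ (i + 1) < h (i + 1) f)
        (q := fun f => θ (i + 1) < h (i + 1) f ∧ f y ≠ b) fun f hf => ⟨hf.2, hf.1.2⟩
      have h4 : mass (ν i) (fun f => θ i < h i f ∧ h (i + 1) f ≤ θ (i + 1)) =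
          mass P (fun f => θ i < h i f ∧ h (i + 1) f ≤ θ (i + 1)) :=
        hloc i _ (((hdep i).mono Finset.subset_union_left).comp₂
          ((hdep (i + 1)).mono Finset.subset_union_right)
          fun z z' => propInd (θ i < z ∧ z' ≤ θ (i + 1)))
      have h5 : mass (ν i) (fun f => θ (i + 1) < h (i + 1) f ∧ f y ≠ b) =
          mass (ν (i + 1)) (fun f => θ (i + 1) < h (i + 1) f ∧ f y ≠ b) :=
        hcons i _ (((hdep (i + 1)).mono Finset.subset_union_left).comp₂
          (hy.mono (Finset.Subset.trans (by simp) Finset.subset_union_right))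
          fun z c => propInd (θ (i + 1) < z ∧ c ≠ b))
      linarith
  have hlast : mass (ν n) (fun f => θ n < h n f ∧ f y ≠ b) ≤
      2 * mass P (fun f => f x ≠ f y) := by
    have hyn : OnlyDependsOn (fun f : V → Bool => f y) (D n) := by rw [hn]; exact hy
    have hd : OnlyDependsOn (fun f => propInd (θ n < h n f ∧ f y ≠ b)) (D n) :=
      (hdep n).comp₂ hyn fun z c => propInd (θ n < z ∧ c ≠ b)
    have hm := sum_mul_condMean hP (hyn.comp fun c => propInd (c ≠ b))
      (fun k => propInd (k x = b))
    rw [mass, hloc n _ (hd.mono Finset.subset_union_left)]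
    have h1 : ∑ f, P f * propInd (θ n < h n f ∧ f y ≠ b) ≤
        2 * ∑ f, P f * (propInd (f y ≠ b) * h n f) := by
      rw [Finset.mul_sum]
      refine Finset.sum_le_sum fun f _ => ?_
      have hnn : 0 ≤ h n f := condMean_nonneg hP _ (fun _ => propInd_nonneg _) f
      have : propInd (θ n < h n f ∧ f y ≠ b) ≤ 2 * (propInd (f y ≠ b) * h n f) := by
        by_cases hf : θ n < h n f ∧ f y ≠ b
        · rw [propInd_true hf, propInd_true hf.2]
          linarith [(hθ n le_rfl).1, hf.1]
        · rw [propInd_false hf]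
          exact mul_nonneg zero_le_two (mul_nonneg (propInd_nonneg _) hnn)
      have := mul_le_mul_of_nonneg_left this (hP f)
      linarith
    refine h1.trans ?_
    rw [hm]
    exact mul_le_mul_of_nonneg_left (Finset.sum_le_sum fun f _ =>
      mul_le_mul_of_nonneg_left (propInd_ne_mul_le b _ _) (hP f)) zero_le_two
  have := hstep n le_rfl
  have := mul_le_mul_of_nonneg_left hend hC
  linarith

section Gluing

variable {V : Type} [Fintype V] [DecidableEq V]

lemma sum_sum_splice (N : Finset V) (G : (V → Bool) → ℝ) :
    ∑ f, ∑ k, G (splice N k f) = Fintype.card (V → Bool) * ∑ f, G f := by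
  let e : (V → Bool) × (V → Bool) ≃ (V → Bool) × (V → Bool) :=
    { toFun := fun p => (splice N p.2 p.1, splice N p.1 p.2)
      invFun := fun p => (splice N p.2 p.1, splice N p.1 p.2)
      left_inv := fun p => by simp only [splice_splice]
      right_inv := fun p => by simp only [splice_splice] }
  rw [← Fintype.sum_prod_type' (f := fun f k => G (splice N k f)),
    Fintype.sum_equiv e (fun p => G (splice N p.2 p.1)) (fun p => G p.1) (fun p => rfl),
    Fintype.sum_prod_type]
  simp [Finset.mul_sum]

/-- The number of assignments that agree with a given one on `N`. -/
noncomputable def numAgree (N : Finset V) : ℝ :=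
  ∑ k : V → Bool, propInd (AgreeOn N k fun _ => false)

lemma numAgree_pos (N : Finset V) : 0 < numAgree N := by
  have := Finset.single_le_sum (f := fun k : V → Bool => propInd (AgreeOn N k fun _ => false))
    (fun k _ => propInd_nonneg _) (mem_univ fun _ => false)
  simp only [propInd_true (AgreeOn.refl N fun _ => false)] at this
  exact zero_lt_one.trans_le this

lemma sum_propInd_agreeOn (N : Finset V) (g : V → Bool) :
    ∑ k : V → Bool, propInd (AgreeOn N k g) = numAgree N := by
  let e : (V → Bool) ≃ (V → Bool) :=
    { toFun := fun k v => xor (k v) (g v)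
      invFun := fun k v => xor (k v) (g v)
      left_inv := fun k => by funext v; simp
      right_inv := fun k => by funext v; simp }
  refine Fintype.sum_equiv e _ _ fun k => ?_
  congr 1
  refine propext (forall₂_congr fun v _ => ?_)
  simp only [e, Equiv.coe_fn_mk]
  cases k v <;> cases g v <;> simp

/-- The conditional weight of the coordinates in `B` given those in `S`. -/
noncomputable def condWeight (ν : (V → Bool) → ℝ) (B S : Finset V) (f : V → Bool) : ℝ :=
  marg ν B f / marg ν S f

lemma condWeight_nonneg {ν : (V → Bool) → ℝ} (hν : ∀ f, 0 ≤ ν f) (B S : Finset V)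
    (f : V → Bool) : 0 ≤ condWeight ν B S f :=
  div_nonneg (marg_nonneg hν _ _) (marg_nonneg hν _ _)

lemma onlyDependsOn_condWeight (ν : (V → Bool) → ℝ) {B S : Finset V} (hS : S ⊆ B) :
    OnlyDependsOn (condWeight ν B S) B :=
  (onlyDependsOn_marg ν B).comp₂ ((onlyDependsOn_marg ν S).mono hS) fun a b => a / b

/-- Integrating out the new coordinates of a conditional weight. -/
lemma sum_mul_condWeight (ν : (V → Bool) → ℝ) {B S Y : Finset V} (hS : S ⊆ B)
    (hY : Y ∩ B ⊆ S) {F φ : (V → Bool) → ℝ} (hF : OnlyDependsOn F Y) (hφ : OnlyDependsOn φ B) :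
    ∑ f, F f * (condWeight ν B S f * φ f) =
      numAgree (B \ S) / Fintype.card (V → Bool) * ∑ f, F f * condMean ν S φ f := by
  set N := B \ S with hN
  have hcard : (Fintype.card (V → Bool) : ℝ) ≠ 0 := by
    exact_mod_cast Fintype.card_ne_zero
  rw [div_mul_eq_mul_div, eq_div_iff hcard, mul_comm, ← sum_sum_splice N, Finset.mul_sum]
  refine Finset.sum_congr rfl fun f _ => ?_
  have hS' : ∀ k, AgreeOn S (splice N k f) f := fun k v hv => by simp [splice, hN, hv]
  have hY' : ∀ k, AgreeOn Y (splice N k f) f := fun k v hv => by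
    have : v ∉ N := fun h => by
      rw [hN, Finset.mem_sdiff] at h
      exact h.2 (hY (Finset.mem_inter.2 ⟨hv, h.1⟩))
    simp [splice, this]
  have hiff : ∀ k g, propInd (AgreeOn B (splice N k f) g) =
      propInd (AgreeOn N k g) * propInd (AgreeOn S f g) := by
    intro k g
    have : AgreeOn B (splice N k f) g ↔ AgreeOn N k g ∧ AgreeOn S f g := by
      constructor
      · refine fun h => ⟨fun v hv => ?_, fun v hv => ?_⟩
        · simpa [splice, hv] using h v (Finset.mem_sdiff.1 hv).1
        · rw [← hS' k v hv]; exact h v (hS hv)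
      · rintro ⟨h1, h2⟩ v hv
        by_cases hvS : v ∈ S
        · rw [hS' k v hvS]; exact h2 v hvS
        · have hvN : v ∈ N := Finset.mem_sdiff.2 ⟨hv, hvS⟩
          simpa [splice, hvN] using h1 v hvN
    by_cases h1 : AgreeOn N k g <;> by_cases h2 : AgreeOn S f g <;>
      simp [propInd, this, h1, h2]
  have hinner : ∑ k, marg ν B (splice N k f) * φ (splice N k f) =
      numAgree N * ∑ g, ν g * propInd (AgreeOn S f g) * φ g := by
    have h1 : ∀ k, marg ν B (splice N k f) * φ (splice N k f) =
        ∑ g, ν g * propInd (AgreeOn S f g) * φ g * propInd (AgreeOn N k g) := by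
      intro k
      rw [marg, Finset.sum_mul]
      refine Finset.sum_congr rfl fun g _ => ?_
      by_cases h : AgreeOn B (splice N k f) g
      · rw [hφ _ _ h, hiff]; ring
      · have h0 := propInd_false h
        rw [h0, mul_zero, zero_mul]
        rw [hiff] at h0
        linear_combination (-(ν g * φ g)) * h0
    simp only [h1]
    rw [Finset.sum_comm, Finset.mul_sum]
    refine Finset.sum_congr rfl fun g _ => ?_
    rw [← Finset.mul_sum, sum_propInd_agreeOn, mul_comm]
  calc _ = ∑ k, F f / marg ν S f * (marg ν B (splice N k f) * φ (splice N k f)) := by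
        refine Finset.sum_congr rfl fun k _ => ?_
        rw [hF _ _ (hY' k), condWeight, onlyDependsOn_marg ν S _ _ (hS' k)]
        ring
    _ = _ := by
        rw [← Finset.mul_sum, hinner, condMean]
        ring

variable {ι : Type} [DecidableEq ι]

/-- Locally consistent distributions on the bags of a tree-like family glue to a global weight
whose marginals on the bags are proportional to the given ones. -/
lemma exists_glued_marginals (B sep : ι → Finset V) (depth : ι → ℕ) (ν : ι → (V → Bool) → ℝ)
    (hν : ∀ i f, 0 ≤ ν i f) (hν1 : ∀ i, ∑ f, ν i f = 1)
    (hcons : ∀ i j φ, OnlyDependsOn φ (B i ∩ B j) → ∑ f, ν i f * φ f = ∑ f, ν j f * φ f)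
    (hsep : ∀ l, sep l ⊆ B l)
    (hrip : ∀ l a, depth a ≤ depth l → a ≠ l → B l ∩ B a ⊆ sep l) (A : Finset ι)
    (hA : ∀ l ∈ A, sep l = ∅ ∨ ∃ p ∈ A, depth p < depth l ∧ sep l ⊆ B p) :
    ∃ c > 0, ∑ f, ∏ j ∈ A, condWeight (ν j) (B j) (sep j) f = c ∧
      ∀ j ∈ A, ∀ φ, OnlyDependsOn φ (B j) →
        ∑ f, (∏ j ∈ A, condWeight (ν j) (B j) (sep j) f) * φ f = c * ∑ f, ν j f * φ f := by
  induction hn : A.card generalizing A with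
  | zero =>
    rw [Finset.card_eq_zero] at hn
    subst hn
    refine ⟨_, ?_, rfl, by simp⟩
    simp
  | succ n ih =>
    obtain ⟨l, hl, hmax⟩ := Finset.exists_max_image A depth
      (Finset.card_pos.1 (by omega))
    have hlA : ∀ p, p ∈ A → depth p < depth l → p ∈ A.erase l := fun p hp hd =>
      Finset.mem_erase.2 ⟨fun h => by rw [h] at hd; exact lt_irrefl _ hd, hp⟩
    obtain ⟨c, hc, hZ1, hZ⟩ := ih (A.erase l) (by
      intro l' hl'
      rcases hA l' (Finset.mem_of_mem_erase hl') with h | ⟨p, hp, hd, hsp⟩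
      · exact Or.inl h
      · exact Or.inr ⟨p, hlA p hp (hd.trans_le (hmax l' (Finset.mem_of_mem_erase hl'))),
          hd, hsp⟩) (by rw [Finset.card_erase_of_mem hl]; omega)
    set W : (V → Bool) → ℝ := fun f => ∏ j ∈ A.erase l, condWeight (ν j) (B j) (sep j) f with hW
    have hW0 : ∀ f, 0 ≤ W f := fun f => Finset.prod_nonneg fun j _ =>
      condWeight_nonneg (hν j) _ _ _
    set Y := (A.erase l).biUnion B with hY
    have hBY : ∀ j ∈ A.erase l, B j ⊆ Y := fun j hj v hv => Finset.mem_biUnion.2 ⟨j, hj, hv⟩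
    have hWdep : OnlyDependsOn W Y := fun f g hfg => Finset.prod_congr rfl fun j hj =>
      ((onlyDependsOn_condWeight (ν j) (hsep j)).mono (hBY j hj)) f g hfg
    have hYB : Y ∩ B l ⊆ sep l := by
      intro v hv
      obtain ⟨h1, h2⟩ := Finset.mem_inter.1 hv
      obtain ⟨j, hj, hvj⟩ := Finset.mem_biUnion.1 h1
      exact hrip l j (hmax j (Finset.mem_of_mem_erase hj)) (Finset.ne_of_mem_erase hj)
        (Finset.mem_inter.2 ⟨h2, hvj⟩)
    have hprod : ∀ f, ∏ j ∈ A, condWeight (ν j) (B j) (sep j) f =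
        W f * condWeight (ν l) (B l) (sep l) f := fun f =>
      (Finset.prod_erase_mul A _ hl).symm
    have hsepZ : ∀ ψ, OnlyDependsOn ψ (sep l) → ∑ f, W f * ψ f = c * ∑ f, ν l f * ψ f := by
      intro ψ hψ
      rcases hA l hl with h | ⟨p, hp, hd, hsp⟩
      · have hconst : ∀ f, ψ f = ψ fun _ => false := fun f => hψ _ _ (by
          rw [h]; intro v hv; exact absurd hv (Finset.notMem_empty v))
        have h1 : ∑ f, W f * ψ f = (∑ f, W f) * ψ fun _ => false := by
          rw [Finset.sum_mul]; exact Finset.sum_congr rfl fun f _ => by rw [hconst f]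
        have h2 : ∑ f, ν l f * ψ f = (∑ f, ν l f) * ψ fun _ => false := by
          rw [Finset.sum_mul]; exact Finset.sum_congr rfl fun f _ => by rw [hconst f]
        rw [h1, h2, hν1, one_mul, hZ1]
      · rw [hZ p (hlA p hp hd) ψ (hψ.mono hsp),
          hcons p l ψ (hψ.mono (Finset.subset_inter hsp (hsep l)))]
    set κ := numAgree (B l \ sep l) / (Fintype.card (V → Bool) : ℝ) with hκ
    have hκ0 : 0 < κ := div_pos (numAgree_pos _) (by exact_mod_cast Fintype.card_pos)
    have hnull : ∀ f, W f * (marg (ν l) (sep l) f / marg (ν l) (sep l) f) = W f := by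
      have h0 : ∑ f, W f * propInd (marg (ν l) (sep l) f = 0) = 0 := by
        rw [hsepZ _ ((onlyDependsOn_marg (ν l) (sep l)).comp fun z => propInd (z = 0))]
        refine mul_eq_zero_of_right _ (Finset.sum_eq_zero fun f _ => ?_)
        by_cases h : marg (ν l) (sep l) f = 0
        · have : ν l f = 0 := le_antisymm (h ▸ le_marg (hν l) (sep l) f) (hν l f)
          rw [this, zero_mul]
        · rw [propInd_false h, mul_zero]
      intro f
      by_cases h : marg (ν l) (sep l) f = 0
      · have := (Finset.sum_eq_zero_iff_of_nonneg fun f _ =>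
          mul_nonneg (hW0 f) (propInd_nonneg _)).1 h0 f (mem_univ f)
        rw [propInd_true h, mul_one] at this
        rw [this, zero_mul]
      · rw [div_self h, mul_one]
    have hold : ∀ φ, OnlyDependsOn φ Y →
        ∑ f, (∏ j ∈ A, condWeight (ν j) (B j) (sep j) f) * φ f = κ * ∑ f, W f * φ f := by
      intro φ hφ
      have := sum_mul_condWeight (ν l) (hsep l) hYB (hWdep.comp₂ hφ fun a b => a * b)
        (φ := fun _ => 1) (fun _ _ _ => rfl)
      calc _ = ∑ f, W f * φ f * (condWeight (ν l) (B l) (sep l) f * 1) :=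
            Finset.sum_congr rfl fun f _ => by rw [hprod]; ring
        _ = _ := this
        _ = _ := by
            rw [← hκ]
            refine congrArg _ (Finset.sum_congr rfl fun f _ => ?_)
            have h1 : condMean (ν l) (sep l) (fun _ => 1) f =
                marg (ν l) (sep l) f / marg (ν l) (sep l) f := by
              simp only [condMean, mul_one]; rfl
            rw [h1, mul_right_comm, hnull]
    refine ⟨κ * c, mul_pos hκ0 hc, ?_, ?_⟩
    · have := hold (fun _ => 1) fun _ _ _ => rfl
      simp only [mul_one] at this
      rw [this, hZ1]
    · intro j hj φ hφ
      by_cases hjl : j = l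
      · subst hjl
        have := sum_mul_condWeight (ν j) (hsep j) hYB hWdep hφ
        have h1 := sum_mul_condMean (hν j) (φ := fun _ => 1) (D := sep j)
          (fun _ _ _ => rfl) φ
        simp only [one_mul] at h1
        rw [hsepZ _ (onlyDependsOn_condMean _ _ _), h1, ← hκ, ← mul_assoc] at this
        rw [← this]
        exact Finset.sum_congr rfl fun f _ => by rw [hprod]; ring
      · have hj' := Finset.mem_erase.2 ⟨hjl, hj⟩
        rw [hold φ (hφ.mono (hBY j hj')), hZ j hj' φ hφ, mul_assoc]

end Gluing

section TreeSeparation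

variable {V : Type} {G : SimpleGraph V}

/-- The nodes on the side of `a` after deleting the tree edge `ab`. -/
def TreeDecomp.side (td : TreeDecomp G) (a b : td.ι) : Set td.ι :=
  {c | (td.T.deleteEdges {s(a, b)}).Reachable a c}

lemma TreeDecomp.left_mem_side (td : TreeDecomp G) (a b : td.ι) : a ∈ td.side a b :=
  SimpleGraph.Reachable.refl a

lemma TreeDecomp.right_notMem_side (td : TreeDecomp G) {a b : td.ι} (hab : td.T.Adj a b) :
    b ∉ td.side a b :=
  SimpleGraph.isBridge_iff.1 (SimpleGraph.isAcyclic_iff_forall_adj_isBridge.1 td.acyclic hab)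

lemma TreeDecomp.mem_side_of_adj (td : TreeDecomp G) {a b c c' : td.ι} (hc : c ∈ td.side a b)
    (hcc : td.T.Adj c c') (hne : s(c, c') ≠ s(a, b)) : c' ∈ td.side a b :=
  SimpleGraph.Reachable.trans hc (SimpleGraph.Adj.reachable
    (SimpleGraph.deleteEdges_adj.2 ⟨hcc, fun h => hne (Set.mem_singleton_iff.1 h)⟩))

/-- A vertex occurring on both sides of a tree edge lies in both bags of that edge. -/
lemma TreeDecomp.mem_bags_of_side (td : TreeDecomp G) {a b c c' : td.ι}
    (hc : c ∈ td.side a b) (hc' : c' ∉ td.side a b) {v : V} (hv : v ∈ td.bags c)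
    (hv' : v ∈ td.bags c') : v ∈ td.bags a ∧ v ∈ td.bags b := by
  obtain ⟨p⟩ := (td.bags_connected v).preconnected ⟨c, hv⟩ ⟨c', hv'⟩
  obtain ⟨d, -, hd1, hd2⟩ := p.exists_boundary_dart {i | i.1 ∈ td.side a b} hc hc'
  have hadj : td.T.Adj d.fst.1 d.snd.1 := d.adj
  have heq : s(d.fst.1, d.snd.1) = s(a, b) := by
    by_contra hne
    exact hd2 (td.mem_side_of_adj hd1 hadj hne)
  have h1 : v ∈ td.bags d.fst.1 := d.fst.2
  have h2 : v ∈ td.bags d.snd.1 := d.snd.2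
  rcases Sym2.eq_iff.1 heq with ⟨e1, e2⟩ | ⟨e1, e2⟩
  · rw [← e1, ← e2]; exact ⟨h1, h2⟩
  · rw [← e1, ← e2]; exact ⟨h2, h1⟩

lemma exists_adj_dist_eq {ι : Type} {T : SimpleGraph ι} (hT : T.Connected) {ρ l : ι}
    (hl : l ≠ ρ) : ∃ p, T.Adj l p ∧ T.dist p ρ < T.dist l ρ := by
  obtain ⟨p, hp⟩ := hT.exists_walk_length_eq_dist l ρ
  cases p with
  | nil => exact absurd rfl hl
  | cons h q =>
    refine ⟨_, h, ?_⟩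
    rw [SimpleGraph.Walk.length_cons] at hp
    have := SimpleGraph.dist_le q
    omega

/-- A tree decomposition can be rooted. -/
lemma TreeDecomp.exists_rooted [DecidableEq V] (td : TreeDecomp G) :
    ∃ (depth : td.ι → ℕ) (sep : td.ι → Finset V), (∀ l, sep l ⊆ td.bags l) ∧
      (∀ l a, depth a ≤ depth l → a ≠ l → td.bags l ∩ td.bags a ⊆ sep l) ∧
      ∀ l, sep l = ∅ ∨ ∃ p, depth p < depth l ∧ sep l ⊆ td.bags p := by
  classical
  obtain ⟨ρ⟩ := td.connected.nonempty
  have hpar : ∀ l, ∃ p, l ≠ ρ → td.T.Adj l p ∧ td.T.dist p ρ < td.T.dist l ρ := by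
    intro l
    by_cases hl : l = ρ
    · exact ⟨l, fun h => absurd hl h⟩
    · obtain ⟨p, hp⟩ := exists_adj_dist_eq td.connected hl
      exact ⟨p, fun _ => hp⟩
  choose par hpar using hpar
  have havoid : ∀ l b n a, td.T.dist a ρ = n → n ≤ td.T.dist l ρ → a ≠ l → l ≠ ρ →
      (td.T.deleteEdges {s(l, b)}).Reachable ρ a := by
    intro l b n
    induction n with
    | zero =>
      intro a ha _ _ _
      rw [(td.connected.dist_eq_zero_iff).1 ha]
    | succ n ih =>
      intro a ha hn hal hl
      have haρ : a ≠ ρ := by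
        rintro rfl
        rw [SimpleGraph.dist_self] at ha
        omega
      obtain ⟨p, hp⟩ := td.connected.exists_walk_length_eq_dist a ρ
      cases p with
      | nil => exact absurd rfl haρ
      | @cons _ a' _ h q =>
        rw [SimpleGraph.Walk.length_cons] at hp
        have h1 := SimpleGraph.dist_le q
        have h2 : td.T.dist a ρ ≤ td.T.dist a' ρ + 1 := by
          have h3 := td.connected.dist_triangle (u := a) (v := a') (w := ρ)
          have h4 := SimpleGraph.dist_eq_one_iff_adj.2 h
          omega
        have ha'l : a' ≠ l := by
          rintro rfl
          omega
        refine (ih a' (by omega) (by omega) ha'l hl).trans (SimpleGraph.Adj.reachable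
          (SimpleGraph.deleteEdges_adj.2 ⟨h.symm, fun hm => ?_⟩))
        rcases Sym2.eq_iff.1 (Set.mem_singleton_iff.1 hm) with ⟨e1, -⟩ | ⟨-, e2⟩
        · exact ha'l e1
        · exact hal e2
  refine ⟨fun l => td.T.dist l ρ, fun l => if l = ρ then ∅ else td.bags l ∩ td.bags (par l),
    fun l => ?_, fun l a hd hal => ?_, fun l => ?_⟩
  · beta_reduce
    split_ifs
    · exact Finset.empty_subset _
    · exact Finset.inter_subset_left
  · by_cases hl : l = ρ
    · subst hl
      simp only [SimpleGraph.dist_self, Nat.le_zero] at hd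
      exact absurd ((td.connected.dist_eq_zero_iff).1 hd) hal
    · simp only [hl, if_false]
      obtain ⟨hadj, hlt⟩ := hpar l hl
      have ha : a ∉ td.side l (par l) := fun ha =>
        td.right_notMem_side hadj (SimpleGraph.Reachable.trans ha
          ((havoid l (par l) _ a rfl hd hal hl).symm.trans
            (havoid l (par l) _ (par l) rfl hlt.le hadj.ne' hl)))
      intro v hv
      obtain ⟨h1, h2⟩ := Finset.mem_inter.1 hv
      exact Finset.mem_inter.2 (td.mem_bags_of_side (td.left_mem_side l (par l)) ha h1 h2)
  · by_cases hl : l = ρ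
    · exact Or.inl (by simp [hl])
    · refine Or.inr ⟨par l, (hpar l hl).2, ?_⟩
      simp only [hl, if_false]
      exact Finset.inter_subset_right

/-- Locally consistent distributions on the bags of a tree decomposition are the marginals of a
Markov global distribution. -/
lemma TreeDecomp.exists_global [Fintype V] [DecidableEq V] (td : TreeDecomp G)
    (ν : td.ι → (V → Bool) → ℝ) (hν : ∀ i f, 0 ≤ ν i f) (hν1 : ∀ i, ∑ f, ν i f = 1)
    (hcons : ∀ i j φ, OnlyDependsOn φ (td.bags i ∩ td.bags j) →
      ∑ f, ν i f * φ f = ∑ f, ν j f * φ f) :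
    ∃ P : (V → Bool) → ℝ, (∀ f, 0 ≤ P f) ∧
      (∀ j φ, OnlyDependsOn φ (td.bags j) → ∑ f, P f * φ f = ∑ f, ν j f * φ f) ∧
      ∀ X S : Finset V, (∀ j, td.bags j ⊆ X ∨ td.bags j ∩ X ⊆ S) →
        ∀ f k, AgreeOn S f k → P f * P k = P (splice X k f) * P (splice X f k) := by
  classical
  have := td.fintype_ι
  obtain ⟨depth, sep, hsep, hrip, hpar⟩ := td.exists_rooted
  obtain ⟨c, hc, -, hZ⟩ := exists_glued_marginals td.bags sep depth ν hν hν1 hcons hsep hrip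
    univ (fun l _ => (hpar l).imp_right fun ⟨p, hp⟩ => ⟨p, mem_univ p, hp⟩)
  refine ⟨fun f => c⁻¹ * ∏ j, condWeight (ν j) (td.bags j) (sep j) f, fun f => ?_, ?_, ?_⟩
  · exact mul_nonneg (inv_nonneg.2 hc.le)
      (Finset.prod_nonneg fun j _ => condWeight_nonneg (hν j) _ _ _)
  · intro j φ hφ
    simp only [mul_assoc]
    rw [← Finset.mul_sum, hZ j (mem_univ j) φ hφ, inv_mul_cancel_left₀ hc.ne']
  · intro X S hX f k hfk
    have : (∏ j, condWeight (ν j) (td.bags j) (sep j) f) *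
        (∏ j, condWeight (ν j) (td.bags j) (sep j) k) =
        (∏ j, condWeight (ν j) (td.bags j) (sep j) (splice X k f)) *
        (∏ j, condWeight (ν j) (td.bags j) (sep j) (splice X f k)) := by
      rw [← Finset.prod_mul_distrib, ← Finset.prod_mul_distrib]
      refine Finset.prod_congr rfl fun j _ => ?_
      have hdep := onlyDependsOn_condWeight (ν j) (hsep j)
      rcases hX j with h | h
      · rw [hdep (splice X k f) k fun v hv => by simp [splice, h hv],
          hdep (splice X f k) f fun v hv => by simp [splice, h hv], mul_comm]
      · have hsame : ∀ f k, AgreeOn S f k → AgreeOn (td.bags j) (splice X k f) f := by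
          intro f k hfk v hv
          by_cases hvX : v ∈ X
          · exact agreeOn_splice hfk v (h (Finset.mem_inter.2 ⟨hv, hvX⟩))
          · simp [splice, hvX]
        rw [hdep _ _ (hsame f k hfk), hdep _ _ (hsame k f hfk.symm)]
    calc _ = c⁻¹ * c⁻¹ * ((∏ j, condWeight (ν j) (td.bags j) (sep j) f) *
        (∏ j, condWeight (ν j) (td.bags j) (sep j) k)) := by ring
      _ = _ := by rw [this]; ring

/-- Any two vertices are joined by a chain of separators of the tree decomposition. -/
lemma TreeDecomp.exists_separator_chain [Fintype V] [DecidableEq V] (td : TreeDecomp G)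
    (x y : V) :
    ∃ (n : ℕ) (D : ℕ → Finset V) (β : ℕ → td.ι), D 0 = {x} ∧ D n = {y} ∧
      (∀ i, D i ∪ D (i + 1) ⊆ td.bags (β i)) ∧
      ∀ i, D (i + 1) ⊆ D i ∨ ∃ X : Finset V, x ∈ X ∧
        (∀ j, td.bags j ⊆ X ∨ td.bags j ∩ X ⊆ D i) ∧ D (i + 1) ∩ X ⊆ D i := by
  classical
  obtain ⟨a, ha⟩ := td.covers_vertices x
  obtain ⟨b, hb⟩ := td.covers_vertices y
  obtain ⟨p, hp⟩ := td.connected.exists_isPath a b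
  set D : ℕ → Finset V := fun i => if i = 0 then {x} else if i ≤ p.length then
    td.bags (p.getVert (i - 1)) ∩ td.bags (p.getVert i) else {y} with hD
  have hDzero : D 0 = {x} := by simp [hD]
  have hDmid : ∀ i, i + 1 ≤ p.length →
      D (i + 1) = td.bags (p.getVert i) ∩ td.bags (p.getVert (i + 1)) := by
    intro i hi; simp [hD, hi]
  have hDend : ∀ i, p.length < i → D i = {y} := by
    intro i hi
    simp only [hD]
    rw [if_neg (by omega), if_neg (by omega)]
  have hyend : ∀ i, p.length ≤ i → ({y} : Finset V) ⊆ td.bags (p.getVert i) := by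
    intro i hi
    rw [p.getVert_of_length_le hi]
    simpa using hb
  have hleft : ∀ i, D i ⊆ td.bags (p.getVert i) := by
    intro i
    cases i with
    | zero => rw [hDzero, SimpleGraph.Walk.getVert_zero]; simpa using ha
    | succ i =>
      by_cases hi : i + 1 ≤ p.length
      · rw [hDmid i hi]; exact Finset.inter_subset_right
      · rw [hDend _ (by omega)]; exact hyend _ (by omega)
  have hright : ∀ i, D (i + 1) ⊆ td.bags (p.getVert i) := by
    intro i
    by_cases hi : i + 1 ≤ p.length
    · rw [hDmid i hi]; exact Finset.inter_subset_left
    · rw [hDend _ (by omega)]; exact hyend _ (by omega)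
  refine ⟨p.length + 1, D, p.getVert, hDzero, hDend _ (by omega),
    fun i => Finset.union_subset (hleft i) (hright i), fun i => ?_⟩
  cases i with
  | zero =>
    refine Or.inr ⟨{x}, by simp, fun j => Or.inr ?_, ?_⟩
    · rw [hDzero]; exact Finset.inter_subset_right
    · rw [hDzero]; exact Finset.inter_subset_right
  | succ i =>
    by_cases hi : i + 1 ≤ p.length
    · have hadj := p.adj_getVert_succ (i := i) (by omega)
      have hprefix : ∀ j, j ≤ i → p.getVert j ∈ td.side (p.getVert i) (p.getVert (i + 1)) := by
        intro j hj
        induction hk : i - j generalizing j with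
        | zero =>
          obtain rfl : j = i := by omega
          exact td.left_mem_side _ _
        | succ k ih =>
          refine td.mem_side_of_adj (ih (j + 1) (by omega) (by omega))
            (p.adj_getVert_succ (i := j) (by omega)).symm fun he => ?_
          have hinj : ∀ s, s ≤ i → p.getVert s ≠ p.getVert (i + 1) := fun s hs h => by
            have := hp.getVert_injOn (show s ∈ {i | i ≤ p.length} from (by omega : s ≤ p.length))
              (show i + 1 ∈ {i | i ≤ p.length} from hi) h
            omega
          rcases Sym2.eq_iff.1 he with ⟨-, e⟩ | ⟨e, -⟩
          · exact hinj j hj e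
          · exact hinj (j + 1) (by omega) e
      have ha' : a ∈ td.side (p.getVert i) (p.getVert (i + 1)) := by
        simpa using hprefix 0 (Nat.zero_le _)
      have hb' := td.right_notMem_side hadj
      set X : Finset V := univ.filter fun v =>
        ∃ c ∈ td.side (p.getVert i) (p.getVert (i + 1)), v ∈ td.bags c with hX
      have hcut : ∀ j, j ∉ td.side (p.getVert i) (p.getVert (i + 1)) →
          td.bags j ∩ X ⊆ D (i + 1) := by
        intro j hj v hv
        obtain ⟨h1, h2⟩ := Finset.mem_inter.1 hv
        obtain ⟨-, c, hc, hvc⟩ := Finset.mem_filter.1 h2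
        rw [hDmid i hi]
        exact Finset.mem_inter.2 (td.mem_bags_of_side hc hj hvc h1)
      refine Or.inr ⟨X, Finset.mem_filter.2 ⟨mem_univ x, a, ha', ha⟩, fun j => ?_, ?_⟩
      · by_cases hj : j ∈ td.side (p.getVert i) (p.getVert (i + 1))
        · exact Or.inl fun v hv => Finset.mem_filter.2 ⟨mem_univ v, j, hj, hv⟩
        · exact Or.inr (hcut j hj)
      · exact (Finset.inter_subset_inter_right (hright (i + 1))).trans (hcut _ hb')
    · refine Or.inl ?_
      rw [hDend (i + 1) (by omega), hDend (i + 1 + 1) (by omega)]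

end TreeSeparation

lemma sum_mul_eq_of_marg_eq {V : Type} [Fintype V] [DecidableEq V] {P P' : (V → Bool) → ℝ}
    {D : Finset V} (h : ∀ f, marg P D f = marg P' D f) {φ : (V → Bool) → ℝ}
    (hφ : OnlyDependsOn φ D) : ∑ f, P f * φ f = ∑ f, P' f * φ f := by
  have key : ∀ R : (V → Bool) → ℝ, ∑ f, marg R D f * φ f = numAgree D * ∑ k, R k * φ k := by
    intro R
    simp only [marg, Finset.sum_mul, Finset.mul_sum]
    rw [Finset.sum_comm]
    refine Finset.sum_congr rfl fun k _ => ?_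
    rw [← sum_propInd_agreeOn D k, Finset.sum_mul]
    refine Finset.sum_congr rfl fun f _ => ?_
    by_cases hfk : AgreeOn D f k
    · rw [hφ f k hfk]; ring
    · rw [propInd_false hfk]; ring
  have h1 := key P
  simp only [h] at h1
  rw [key P'] at h1
  exact (mul_left_cancel₀ (numAgree_pos D).ne' h1).symm

lemma sum_filter_eq_mass {Ω : Type} [Fintype Ω] (P : Ω → ℝ) (p : Ω → Prop) [DecidablePred p] :
    ∑ ω ∈ univ.filter p, P ω = mass P p := by
  rw [Finset.sum_filter]
  refine Finset.sum_congr rfl fun ω _ => ?_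
  by_cases h : p ω
  · rw [if_pos h, propInd_true h, mul_one]
  · rw [if_neg h, propInd_false h, mul_zero]

lemma mass_agree_eq_marg {V : Type} [Fintype V] [DecidableEq V] (P : (V → Bool) → ℝ)
    (D : Finset V) (h : V → Bool) : mass P (fun g => ∀ x ∈ D, g x = h x) = marg P D h :=
  Finset.sum_congr rfl fun g _ => by
    congr 2
    exact propext ⟨fun hg x hx => (hg x hx).symm, fun hg x hx => (hg x hx).symm⟩

lemma mass_ne_eq {V : Type} [Fintype V] [DecidableEq V] (P : (V → Bool) → ℝ) (x y : V) :
    mass P (fun f => f x ≠ f y) =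
      mass P (fun f => f x = true ∧ f y ≠ true) + mass P (fun f => f x = false ∧ f y ≠ false) := by
  rw [mass, mass, mass, ← Finset.sum_add_distrib]
  refine Finset.sum_congr rfl fun f _ => ?_
  cases hx : f x <;> cases hy : f y <;> simp [propInd]

lemma onlyDependsOn_ne {V : Type} {D : Finset V} {x y : V} (hx : x ∈ D) (hy : y ∈ D) :
    OnlyDependsOn (fun f : V → Bool => propInd (f x ≠ f y)) D :=
  (onlyDependsOn_eval hx).comp₂ (onlyDependsOn_eval hy) fun a b => propInd (a ≠ b)

lemma walkLen_nonneg {V : Type} {G : SimpleGraph V} {w : V → V → ℝ}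
    (hw : ∀ u v, G.Adj u v → 0 < w u v) {x y : V} (p : G.Walk x y) : 0 ≤ walkLen G w p := by
  refine List.sum_nonneg fun z hz => ?_
  obtain ⟨d, -, rfl⟩ := List.mem_map.1 hz
  exact (hw _ _ d.adj).le

lemma spDist_le_of_adj {V : Type} {G : SimpleGraph V} {w : V → V → ℝ}
    (hw : ∀ u v, G.Adj u v → 0 < w u v) {u v : V} (h : G.Adj u v) : spDist G w u v ≤ w u v := by
  refine csInf_le ⟨0, ?_⟩ ⟨h.toWalk, ?_⟩
  · rintro _ ⟨p, rfl⟩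
    exact walkLen_nonneg hw p
  · simp [walkLen]

lemma mass_ne_triangle {V : Type} [Fintype V] [DecidableEq V] {P : (V → Bool) → ℝ}
    (hP : ∀ f, 0 ≤ P f) (x y z : V) : mass P (fun f => f x ≠ f z) ≤
      mass P (fun f => f x ≠ f y) + mass P (fun f => f y ≠ f z) := by
  rw [mass, mass, mass, ← Finset.sum_add_distrib]
  refine Finset.sum_le_sum fun f _ => ?_
  rw [← mul_add]
  refine mul_le_mul_of_nonneg_left ?_ (hP f)
  cases f x <;> cases f y <;> cases f z <;> simp [propInd]

/-- A cut metric dominated by the edge lengths is dominated by the shortest-path metric. -/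
lemma mass_ne_le_spDist {V : Type} [Fintype V] [DecidableEq V] {G : SimpleGraph V}
    (hG : G.Connected) {w : V → V → ℝ} {P : (V → Bool) → ℝ} (hP : ∀ f, 0 ≤ P f) {M : ℝ} (hM : 0 ≤ M)
    (h : ∀ u v, G.Adj u v → M * mass P (fun f => f u ≠ f v) ≤ w u v) (x y : V) :
    M * mass P (fun f => f x ≠ f y) ≤ spDist G w x y := by
  refine le_csInf ?_ ?_
  · obtain ⟨p⟩ := hG.preconnected x y
    exact ⟨_, p, rfl⟩
  · rintro _ ⟨p, rfl⟩
    induction p with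
    | nil => simp [walkLen, mass, propInd]
    | @cons u v z huv q ih =>
      have h1 := mul_le_mul_of_nonneg_left (mass_ne_triangle hP u v z) hM
      have h2 : walkLen G w (SimpleGraph.Walk.cons huv q) = w u v + walkLen G w q := by
        simp [walkLen]
      rw [h2]
      linarith [h u v huv]

/-- A weighted family of cuts is an `ℓ₁` embedding. -/
lemma exists_cut_embedding {V : Type} [Fintype V] [DecidableEq V] {P : (V → Bool) → ℝ}
    (hP : ∀ f, 0 ≤ P f) {s : ℝ} (hs : 0 ≤ s) :
    ∃ (m : ℕ) (φ : V → Fin m → ℝ), ∀ x y,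
      ∑ i, |φ x i - φ y i| = s * mass P (fun f => f x ≠ f y) := by
  let e := Fintype.equivFin (V → Bool)
  refine ⟨_, fun x i => s * (P (e.symm i) * propInd (e.symm i x = true)), fun x y => ?_⟩
  rw [e.symm.sum_comp fun f => |s * (P f * propInd (f x = true)) -
    s * (P f * propInd (f y = true))|, mass, Finset.mul_sum]
  refine Finset.sum_congr rfl fun f _ => ?_
  rw [← mul_sub, ← mul_sub, abs_mul, abs_mul, abs_of_nonneg hs, abs_of_nonneg (hP f)]
  congr 2
  cases f x <;> cases f y <;> simp [propInd]

open scoped Classical in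
/-- Corollary 1 of the paper: for every `r` there is a constant `C(r)` such
that every shortest-path metric of a graph of treewidth at most `r` admitting locally
consistent distributions over cuts on every `r+3` vertices that locally isometrically realize
the metric (up to a global scale `M`) embeds into `ℓ₁` with distortion at most `C`. -/
theorem stmt13 (r : ℕ) (hr : 0 < r) :
    ∃ C : ℝ,
      ∀ (V : Type) [Fintype V] [DecidableEq V],
      ∀ (G : SimpleGraph V) (w : V → V → ℝ) (td : TreeDecomp G)
        (M : ℝ) (μ : Finset V → (V → Bool) → ℝ),
        G.Connected → r + 3 ≤ Fintype.card V →
        (∀ i, (td.bags i).card ≤ r + 1) →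
        (∀ u v, w u v = w v u) → (∀ u v, G.Adj u v → 0 < w u v) →
        0 < M →
        -- each `μ S` is a probability distribution on assignments (cuts) of `S`
        (∀ S : Finset V, S.card = r + 3 → (∀ g, 0 ≤ μ S g) ∧ (∑ g, μ S g = 1)) →
        -- local consistency: the restrictions to `S ∩ S'` agree
        (∀ S S' : Finset V, S.card = r + 3 → S'.card = r + 3 → ∀ h : V → Bool,
          (∑ g ∈ Finset.univ.filter (fun g : V → Bool => ∀ x ∈ S ∩ S', g x = h x), μ S g) =
          (∑ g ∈ Finset.univ.filter (fun g : V → Bool => ∀ x ∈ S ∩ S', g x = h x), μ S' g)) →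
        -- local isometric embeddability into `L₁`, as a distribution over cuts
        (∀ S : Finset V, S.card = r + 3 → ∀ x ∈ S, ∀ y ∈ S,
          M * (∑ g ∈ Finset.univ.filter (fun g : V → Bool => g x ≠ g y), μ S g) =
            spDist G w x y) →
        ∃ (m : ℕ) (φ : V → Fin m → ℝ), ∀ x y : V,
          spDist G w x y ≤ (∑ i, |φ x i - φ y i|) ∧
          (∑ i, |φ x i - φ y i|) ≤ C * spDist G w x y := by
  obtain ⟨C, hC, hcore⟩ := exists_local_le_global r
  refine ⟨2 * C, ?_⟩
  intro V _ _ G w td M μ hG hcardV hbag _ hw hM hμ hcons hiso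
  have hagree : ∀ S S' : Finset V, S.card = r + 3 → S'.card = r + 3 → ∀ φ,
      OnlyDependsOn φ (S ∩ S') → ∑ f, μ S f * φ f = ∑ f, μ S' f * φ f := by
    intro S S' hS hS' φ hφ
    refine sum_mul_eq_of_marg_eq (fun h => ?_) hφ
    have := hcons S S' hS hS' h
    rwa [sum_filter_eq_mass, sum_filter_eq_mass, mass_agree_eq_marg, mass_agree_eq_marg] at this
  have hdist : ∀ S : Finset V, S.card = r + 3 → ∀ x ∈ S, ∀ y ∈ S,
      M * mass (μ S) (fun g => g x ≠ g y) = spDist G w x y := by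
    intro S hS x hx y hy
    rw [← hiso S hS x hx y hy, sum_filter_eq_mass]
  have hext : ∀ A : Finset V, A.card ≤ r + 3 → ∃ S, A ⊆ S ∧ S.card = r + 3 := fun A hA =>
    Finset.exists_superset_card_eq hA hcardV
  choose S hBS hS using fun i => hext (td.bags i) ((hbag i).trans (by omega))
  obtain ⟨P, hP, hloc, hswap⟩ := td.exists_global (fun i => μ (S i)) (fun i => (hμ _ (hS i)).1)
    (fun i => (hμ _ (hS i)).2) fun i j φ hφ =>
      hagree _ _ (hS i) (hS j) φ (hφ.mono (Finset.inter_subset_inter (hBS i) (hBS j)))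
  have hupper : ∀ x y, M * mass P (fun f => f x ≠ f y) ≤ spDist G w x y := by
    refine mass_ne_le_spDist hG hP hM.le fun u v huv => ?_
    obtain ⟨i, hu, hv⟩ := td.covers_edges u v huv
    refine le_trans (le_of_eq ?_) (spDist_le_of_adj hw huv)
    rw [← hdist (S i) (hS i) u (hBS i hu) v (hBS i hv)]
    exact congrArg _ (hloc i _ (onlyDependsOn_ne hu hv))
  have hlower : ∀ x y, spDist G w x y ≤ 2 * C * M * mass P (fun f => f x ≠ f y) := by
    intro x y
    obtain ⟨n, D, β, hD0, hDn, hDβ, hmark⟩ := td.exists_separator_chain x y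
    choose S' hBS' hS' using fun i => hext (td.bags (β i) ∪ {x, y})
      (by
        have h1 := Finset.card_union_le (td.bags (β i)) {x, y}
        have h2 := Finset.card_le_two (a := x) (b := y)
        have h3 := hbag (β i)
        omega)
    have hxy : ∀ i, ({x, y} : Finset V) ⊆ S' i := fun i =>
      Finset.subset_union_right.trans (hBS' i)
    have hβS' : ∀ i, td.bags (β i) ⊆ S' i := fun i => Finset.subset_union_left.trans (hBS' i)
    have hhalf : ∀ b, mass (μ (S' 0)) (fun f => f x = b ∧ f y ≠ b) ≤
        C * mass P (fun f => f x ≠ f y) := by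
      intro b
      refine hcore V P D (fun i => μ (S' i)) n x y b hP (fun i => (hμ _ (hS' i)).1) hD0 hDn
        (fun i => (Finset.card_le_card (Finset.subset_union_left.trans (hDβ i))).trans
          (hbag (β i))) (fun i φ hφ => ?_) (fun i φ hφ => ?_) (fun i φ hφ => ?_)
      · rw [hloc (β i) φ (hφ.mono (hDβ i))]
        exact hagree _ _ (hS' i) (hS (β i)) φ
          (hφ.mono ((hDβ i).trans (Finset.subset_inter (hβS' i) (hBS (β i)))))
      · refine hagree _ _ (hS' i) (hS' (i + 1)) φ (hφ.mono (Finset.union_subset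
          (Finset.subset_inter ?_ ?_) (Finset.subset_inter (hxy i) (hxy (i + 1)))))
        · exact Finset.subset_union_right.trans ((hDβ i).trans (hβS' i))
        · exact Finset.subset_union_left.trans ((hDβ (i + 1)).trans (hβS' (i + 1)))
      · rcases hmark i with h | ⟨X, hxX, hX, hDX⟩
        · exact sum_mul_condMean hP (hφ.mono h) _
        · exact sum_mul_condMean_of_splice hP (hswap X (D i) hX)
            ((onlyDependsOn_eval hxX).comp fun z => propInd (z = b)) hφ hDX
    have hx := hxy 0 (Finset.mem_insert_self x _)
    have hy := hxy 0 (Finset.mem_insert_of_mem (Finset.mem_singleton_self y))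
    rw [← hdist (S' 0) (hS' 0) x hx y hy, mass_ne_eq]
    have := mul_le_mul_of_nonneg_left (add_le_add (hhalf true) (hhalf false)) hM.le
    linarith
  obtain ⟨m, φ, hφ⟩ := exists_cut_embedding hP (s := 2 * C * M) (by positivity)
  refine ⟨m, φ, fun x y => ⟨?_, ?_⟩⟩
  · rw [hφ]; exact hlower x y
  · rw [hφ, mul_assoc]
    exact mul_le_mul_of_nonneg_left (hupper x y) (by positivity)
end

section
/- Let G = (V,E) be a finite simple graph with V = {v_1,…,v_n}, n ≥ 1, and let MaxCut(G) = max_{A ⊆ V} |{(u,v) ∈ E : exactly one of u,v lies in A}|. Consider the Sparsest-Cut instance on the complete bipartite graph H = K_{2,n} with vertex set {s,t} ∪ {v'_1,…,v'_n}, edges (s,v'_i) and (t,v'_i) of capacity 1 for every i, demand dem(v'_i, v'_j) = 1 for every edge (v_i,v_j) ∈ E, and demand dem(s,t) = n³. Then: (i) the minimum of the sparsity Φ(S) over all S ⊆ V(H) whose cutset crosses positive total demand equals n/(n³ + MaxCut(G)); (ii) every S with s,t on the same side whose cutset crosses positive total demand has Φ(S) strictly greater than n/(n³ + MaxCut(G)),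 so every minimizer separates s from t; and (iii) H admits a path decomposition of width 2, with bags {s, t, v'_i} arranged in a path. -/
open Finset

open scoped Classical

/-- The number of edges of `G` crossing the cut `(A, Aᶜ)` (each unordered crossing edge is
counted exactly once, via its ordered representative leaving `A`). -/
noncomputable def crossEdges {n : ℕ} (G : SimpleGraph (Fin n)) (A : Finset (Fin n)) : ℕ :=
  (Finset.univ.filter fun p : Fin n × Fin n => G.Adj p.1 p.2 ∧ p.1 ∈ A ∧ p.2 ∉ A).card

/-- `MaxCut(G)`: the maximum number of crossing edges over all cuts. -/
noncomputable def maxCutVal {n : ℕ} (G : SimpleGraph (Fin n)) : ℕ :=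
  Finset.univ.sup fun A : Finset (Fin n) => crossEdges G A

/-- The complete bipartite graph `K_{2,n}` on `Fin n ⊕ Fin 2`: the two "right" vertices
`Sum.inr 0 = s` and `Sum.inr 1 = t` are joined to every "left" vertex `Sum.inl i = v'_i`. -/
noncomputable def Kgraph (n : ℕ) : SimpleGraph (Fin n ⊕ Fin 2) :=
  SimpleGraph.fromRel fun a b => a.isLeft = true ∧ b.isRight = true

/-- The demands of the Sparsest-Cut instance: demand `1` between `v'_i` and `v'_j` for every
edge `(v_i, v_j)` of `G`, and demand `n³` between `s` and `t`. -/
noncomputable def demH {n : ℕ} (G : SimpleGraph (Fin n)) :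
    (Fin n ⊕ Fin 2) → (Fin n ⊕ Fin 2) → ℝ
  | Sum.inl i, Sum.inl j => if G.Adj i j then 1 else 0
  | Sum.inr a, Sum.inr b => if a ≠ b then (n : ℝ) ^ 3 else 0
  | _, _ => 0

/-- Total (unit) capacity of the edges of `K_{2,n}` crossing the cut `(S, Sᶜ)`. -/
noncomputable def cutCapH (n : ℕ) (S : Finset (Fin n ⊕ Fin 2)) : ℝ :=
  ((Finset.univ.filter fun p : (Fin n ⊕ Fin 2) × (Fin n ⊕ Fin 2) =>
      (Kgraph n).Adj p.1 p.2 ∧ p.1 ∈ S ∧ p.2 ∉ S).card : ℝ)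

/-- Total demand crossing the cut `(S, Sᶜ)` (each unordered pair counted once). -/
noncomputable def cutDemH {n : ℕ} (G : SimpleGraph (Fin n)) (S : Finset (Fin n ⊕ Fin 2)) : ℝ :=
  ∑ a, ∑ b, if a ∈ S ∧ b ∉ S then demH G a b else 0

/-- The bags `{s, t, v'_i}` of the path decomposition of `K_{2,n}`. -/
def bagsH (n : ℕ) (i : Fin n) : Finset (Fin n ⊕ Fin 2) :=
  {Sum.inr 0, Sum.inr 1, Sum.inl i}

/-- The left vertices contained in a cut of `K_{2,n}`. -/
noncomputable def leftPart {n : ℕ} (S : Finset (Fin n ⊕ Fin 2)) : Finset (Fin n) :=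
  Finset.univ.filter fun i => Sum.inl i ∈ S

theorem crossEdges_le_card_mul_card_compl {n : ℕ} (G : SimpleGraph (Fin n))
    (A : Finset (Fin n)) : crossEdges G A ≤ A.card * Aᶜ.card := by
  rw [← Finset.card_product, crossEdges]
  apply Finset.card_le_card
  intro p hp
  simp only [Finset.mem_filter, Finset.mem_product, Finset.mem_compl] at hp ⊢
  exact hp.2.2

theorem crossEdges_le_maxCutVal {n : ℕ} (G : SimpleGraph (Fin n)) (A : Finset (Fin n)) :
    crossEdges G A ≤ maxCutVal G :=
  Finset.le_sup (f := fun A => crossEdges G A) (Finset.mem_univ A)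

theorem exists_crossEdges_eq_maxCutVal {n : ℕ} (G : SimpleGraph (Fin n)) :
    ∃ A : Finset (Fin n), crossEdges G A = maxCutVal G := by
  obtain ⟨A, -, hA⟩ := Finset.exists_mem_eq_sup (Finset.univ : Finset (Finset (Fin n)))
    Finset.univ_nonempty (fun A => crossEdges G A)
  exact ⟨A, hA.symm⟩

theorem cutCapH_eq_sum (n : ℕ) (S : Finset (Fin n ⊕ Fin 2)) :
    cutCapH n S = ∑ i : Fin n,
      ((if Sum.inl i ∈ S ↔ Sum.inr 0 ∈ S then 0 else 1) +
        (if Sum.inl i ∈ S ↔ Sum.inr 1 ∈ S then 0 else 1) : ℝ) := by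
  rw [cutCapH, Finset.card_filter, ← Finset.univ_product_univ, Finset.sum_product]
  push_cast
  simp only [Fintype.sum_sum_type, Fin.sum_univ_two, Kgraph, SimpleGraph.fromRel_adj,
    Finset.sum_add_distrib]
  simp [-Finset.sum_boole]
  simp only [← Finset.sum_add_distrib]
  refine Finset.sum_congr rfl fun i _ => ?_
  by_cases hi : Sum.inl i ∈ S <;> by_cases h0 : Sum.inr 0 ∈ S <;>
    by_cases h1 : Sum.inr 1 ∈ S <;> simp [hi, h0, h1]

theorem cutDemH_eq {n : ℕ} (G : SimpleGraph (Fin n)) (S : Finset (Fin n ⊕ Fin 2)) :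
    cutDemH G S = crossEdges G (leftPart S) +
      if Sum.inr 0 ∈ S ↔ Sum.inr 1 ∈ S then 0 else (n : ℝ) ^ 3 := by
  rw [cutDemH, crossEdges, Finset.card_filter, ← Finset.univ_product_univ, Finset.sum_product]
  push_cast
  simp only [Fintype.sum_sum_type, Fin.sum_univ_two, demH, leftPart, ite_self,
    Finset.sum_const_zero, add_zero, zero_add]
  congr 1
  · refine Finset.sum_congr rfl fun i _ => Finset.sum_congr rfl fun j _ => ?_
    by_cases h : G.Adj i j <;> simp [h]
  · by_cases h0 : Sum.inr 0 ∈ S <;> by_cases h1 : Sum.inr 1 ∈ S <;> simp [h0, h1]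

theorem cutCapH_of_separates (n : ℕ) (S : Finset (Fin n ⊕ Fin 2))
    (h : ¬((Sum.inr 0 : Fin n ⊕ Fin 2) ∈ S ↔ (Sum.inr 1 : Fin n ⊕ Fin 2) ∈ S)) :
    cutCapH n S = n := by
  have hterm : ∀ i : Fin n,
      (((if Sum.inl i ∈ S ↔ Sum.inr 0 ∈ S then 0 else 1) +
        (if Sum.inl i ∈ S ↔ Sum.inr 1 ∈ S then 0 else 1) : ℝ)) = 1 := by
    intro i
    by_cases hi : Sum.inl i ∈ S <;> by_cases h0 : Sum.inr 0 ∈ S <;>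
      by_cases h1 : Sum.inr 1 ∈ S <;> simp_all
  simp [cutCapH_eq_sum, hterm]

theorem cutCapH_of_not_separates (n : ℕ) (S : Finset (Fin n ⊕ Fin 2))
    (h : (Sum.inr 0 : Fin n ⊕ Fin 2) ∈ S ↔ (Sum.inr 1 : Fin n ⊕ Fin 2) ∈ S) :
    cutCapH n S = 2 * (leftPart S).card ∨ cutCapH n S = 2 * (leftPart S)ᶜ.card := by
  rw [cutCapH_eq_sum]
  by_cases h1 : (Sum.inr 1 : Fin n ⊕ Fin 2) ∈ S
  · right
    have h0 := h.2 h1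
    rw [leftPart, Finset.compl_filter, Finset.card_filter]
    push_cast
    rw [Finset.mul_sum]
    refine Finset.sum_congr rfl fun i _ => ?_
    by_cases hi : Sum.inl i ∈ S <;> simp [hi, h0, h1]
    norm_num
  · left
    have h0 : (Sum.inr 0 : Fin n ⊕ Fin 2) ∉ S := fun h' => h1 (h.1 h')
    rw [leftPart, Finset.card_filter]
    push_cast
    rw [Finset.mul_sum]
    refine Finset.sum_congr rfl fun i _ => ?_
    by_cases hi : Sum.inl i ∈ S <;> simp [hi, h0, h1]
    norm_num

theorem div_lt_cutCapH_div_cutDemH_of_not_separates {n : ℕ} (hn : 1 ≤ n)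
    (G : SimpleGraph (Fin n)) (S : Finset (Fin n ⊕ Fin 2)) (hS : 0 < cutDemH G S)
    (h : (Sum.inr 0 : Fin n ⊕ Fin 2) ∈ S ↔ (Sum.inr 1 : Fin n ⊕ Fin 2) ∈ S) :
    (n : ℝ) / ((n : ℝ) ^ 3 + (maxCutVal G : ℝ)) < cutCapH n S / cutDemH G S := by
  have hn' : (1 : ℝ) ≤ n := by exact_mod_cast hn
  have hdem : cutDemH G S = crossEdges G (leftPart S) := by simp [cutDemH_eq, h]
  have hle : (crossEdges G (leftPart S) : ℝ) ≤ (leftPart S).card * (leftPart S)ᶜ.card := by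
    exact_mod_cast crossEdges_le_card_mul_card_compl G (leftPart S)
  have hA : ((leftPart S).card : ℝ) ≤ n := by
    exact_mod_cast card_finset_fin_le (leftPart S)
  have hB : ((leftPart S)ᶜ.card : ℝ) ≤ n := by
    exact_mod_cast card_finset_fin_le (leftPart S)ᶜ
  obtain ⟨k, hk0, hcap, hk⟩ : ∃ k : ℝ, 0 ≤ k ∧ cutCapH n S = 2 * k ∧ cutDemH G S ≤ k * n := by
    rcases cutCapH_of_not_separates n S h with hc | hc
    · exact ⟨_, by positivity, hc, by rw [hdem]; exact hle.trans (by gcongr)⟩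
    · refine ⟨_, by positivity, hc, ?_⟩
      rw [hdem, mul_comm]
      exact hle.trans (by gcongr)
  have hkpos : 0 < k := by
    rcases hk0.eq_or_lt with rfl | hk'
    · linarith
    · exact hk'
  have hM : (0 : ℝ) ≤ maxCutVal G := by positivity
  rw [hcap, div_lt_div_iff₀ (by positivity) hS]
  calc (n : ℝ) * cutDemH G S ≤ n * (k * n) := by gcongr
    _ = k * (n : ℝ) ^ 2 := by ring
    _ ≤ k * (n : ℝ) ^ 3 := by gcongr; norm_num
    _ < 2 * k * ((n : ℝ) ^ 3 + maxCutVal G) := by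
      have : 0 < k * (n : ℝ) ^ 3 := by positivity
      nlinarith [mul_nonneg hk0 hM]

/-- Theorem 3 of the paper / Appendix A: the Max-Cut reduction showing that
Sparsest-Cut is NP-hard already on graphs of pathwidth 2.  (i) The minimum sparsity of the
instance on `K_{2,n}` equals `n/(n³ + MaxCut(G))`; (ii) every cut keeping `s,t` on the same
side (and crossing positive demand) has strictly larger sparsity, so every minimizer separates
`s` from `t`; (iii) the bags `{s,t,v'_i}`, arranged in a path, form a path decomposition of
`K_{2,n}` of width `2`. -/
theorem stmt14 (n : ℕ) (hn : 1 ≤ n) (G : SimpleGraph (Fin n)) :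
    -- (i) the minimum sparsity equals n / (n³ + MaxCut G)
    ((∃ S : Finset (Fin n ⊕ Fin 2), 0 < cutDemH G S ∧
        cutCapH n S / cutDemH G S = (n : ℝ) / ((n : ℝ) ^ 3 + (maxCutVal G : ℝ))) ∧
      (∀ S : Finset (Fin n ⊕ Fin 2), 0 < cutDemH G S →
        (n : ℝ) / ((n : ℝ) ^ 3 + (maxCutVal G : ℝ)) ≤ cutCapH n S / cutDemH G S)) ∧
    -- (ii) cuts not separating s from t are strictly worse
    (∀ S : Finset (Fin n ⊕ Fin 2), 0 < cutDemH G S →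
      ((Sum.inr 0 : Fin n ⊕ Fin 2) ∈ S ↔ (Sum.inr 1 : Fin n ⊕ Fin 2) ∈ S) →
      (n : ℝ) / ((n : ℝ) ^ 3 + (maxCutVal G : ℝ)) < cutCapH n S / cutDemH G S) ∧
    -- (iii) the bags {s, t, v'_i} form a path decomposition of K_{2,n} of width 2
    ((∀ x : Fin n ⊕ Fin 2, ∃ i : Fin n, x ∈ bagsH n i) ∧
      (∀ a b : Fin n ⊕ Fin 2, (Kgraph n).Adj a b → ∃ i, a ∈ bagsH n i ∧ b ∈ bagsH n i) ∧
      (∀ x : Fin n ⊕ Fin 2, ∀ i₁ i₂ i₃ : Fin n, i₁ ≤ i₂ → i₂ ≤ i₃ →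
        x ∈ bagsH n i₁ → x ∈ bagsH n i₃ → x ∈ bagsH n i₂) ∧
      (∀ i : Fin n, (bagsH n i).card ≤ 3)) := by
  have hn' : (1 : ℝ) ≤ n := by exact_mod_cast hn
  refine ⟨⟨?_, ?_⟩, fun S hS h => div_lt_cutCapH_div_cutDemH_of_not_separates hn G S hS h,
    ?_, ?_, ?_, ?_⟩
  · obtain ⟨A, hA⟩ := exists_crossEdges_eq_maxCutVal G
    have hsep : ¬((Sum.inr 0 : Fin n ⊕ Fin 2) ∈ A.disjSum {0} ↔
        (Sum.inr 1 : Fin n ⊕ Fin 2) ∈ A.disjSum {0}) := by simp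
    have hleft : leftPart (A.disjSum ({0} : Finset (Fin 2))) = A := by
      ext i
      simp [leftPart]
    have hdem : cutDemH G (A.disjSum {0}) = (n : ℝ) ^ 3 + maxCutVal G := by
      rw [cutDemH_eq, if_neg hsep, hleft, hA, add_comm]
    refine ⟨A.disjSum {0}, ?_, ?_⟩
    · rw [hdem]
      positivity
    · rw [hdem, cutCapH_of_separates n _ hsep]
  · intro S hS
    by_cases h : (Sum.inr 0 : Fin n ⊕ Fin 2) ∈ S ↔ (Sum.inr 1 : Fin n ⊕ Fin 2) ∈ S
    · exact (div_lt_cutCapH_div_cutDemH_of_not_separates hn G S hS h).le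
    · rw [cutCapH_of_separates n S h]
      have hM : (crossEdges G (leftPart S) : ℝ) ≤ maxCutVal G := by
        exact_mod_cast crossEdges_le_maxCutVal G (leftPart S)
      have hdem : cutDemH G S ≤ (n : ℝ) ^ 3 + maxCutVal G := by
        rw [cutDemH_eq, if_neg h]
        linarith
      gcongr
  · rintro (i | a)
    · exact ⟨i, by simp [bagsH]⟩
    · exact ⟨⟨0, hn⟩, by fin_cases a <;> simp [bagsH]⟩
  · rintro (i | a) (j | b) hab
    · simp [Kgraph] at hab
    · exact ⟨i, by simp [bagsH], by fin_cases b <;> simp [bagsH]⟩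
    · exact ⟨j, by fin_cases a <;> simp [bagsH], by simp [bagsH]⟩
    · simp [Kgraph] at hab
  · rintro (i | a) i₁ i₂ i₃ h₁₂ h₂₃ h₁ h₃
    · simp only [bagsH, Finset.mem_insert, Finset.mem_singleton, reduceCtorEq, false_or,
        Sum.inl.injEq] at h₁ h₃ ⊢
      subst h₁ h₃
      exact le_antisymm h₁₂ h₂₃
    · fin_cases a <;> simp [bagsH]
  · exact fun i => Finset.card_le_three
end

section
/- For every even integer k ≥ 4, every integer N > k, and every ε ∈ (0, 1/(2(N+k))), in the Markov flow graph H_k(N,ε) the following holds for every layer 1 ≤ j ≤ N−1 and every 0 ≤ i ≤ k−1: A(v^j_i) = 1/2 − i/(k−1). -/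
open Finset

/-- A (layered) Markov flow graph: layers `L 0, …, L N` of nodes (pairwise disjoint, nonempty),
an initial distribution `p0` on `L 0`, and transition probabilities `q` supported on pairs of
consecutive layers, with rows summing to `1`. -/
structure MarkovFlow (V : Type) [Fintype V] [DecidableEq V] where
  N : ℕ
  one_le_N : 1 ≤ N
  L : ℕ → Finset V
  layer_nonempty : ∀ l, l ≤ N → (L l).Nonempty
  layer_disjoint : ∀ l m, l ≤ N → m ≤ N → l ≠ m → Disjoint (L l) (L m)
  p0 : V → ℝ
  p0_nonneg : ∀ u, 0 ≤ p0 u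
  p0_supp : ∀ u, u ∉ L 0 → p0 u = 0
  p0_sum : ∑ u ∈ L 0, p0 u = 1
  q : V → V → ℝ
  q_nonneg : ∀ u v, 0 ≤ q u v
  q_le_one : ∀ u v, q u v ≤ 1
  q_supp : ∀ u v, q u v ≠ 0 → ∃ l, l < N ∧ u ∈ L l ∧ v ∈ L (l + 1)
  q_row : ∀ l, l < N → ∀ u ∈ L l, ∑ v ∈ L (l + 1), q u v = 1

namespace MarkovFlow

variable {V : Type} [Fintype V] [DecidableEq V]

/-- The marginal probability `p(u) = Pr[X_l = u]`. -/
noncomputable def pm (M : MarkovFlow V) : ℕ → V → ℝ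
  | 0 => M.p0
  | l + 1 => fun v => ∑ u, pm M l u * M.q u v

/-- The `d`-step transition probability from node `u`. -/
noncomputable def cond (M : MarkovFlow V) (u : V) : ℕ → V → ℝ
  | 0 => fun v => if v = u then 1 else 0
  | d + 1 => fun v => ∑ w, cond M u d w * M.q w v

/-- The joint probability `p(u,v) = Pr[X_{l₁} = u ∧ X_{l₂} = v]` (for `l₁ ≤ l₂`). -/
noncomputable def pj (M : MarkovFlow V) (l₁ l₂ : ℕ) (u v : V) : ℝ :=
  pm M l₁ u * cond M u (l₂ - l₁) v

/-- `A(v) = Pr[X_0 = s₀ ∣ X_l = v] - 1/2 = p(s₀,v)/p(v) - 1/2`. -/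
noncomputable def A (M : MarkovFlow V) (s₀ : V) (l : ℕ) (v : V) : ℝ :=
  pj M 0 l s₀ v / pm M l v - 1 / 2

/-- The potential `φ(l) = Var[A(X_l)]`. -/
noncomputable def phi (M : MarkovFlow V) (s₀ : V) (l : ℕ) : ℝ :=
  (∑ v ∈ M.L l, pm M l v * (A M s₀ l v) ^ 2) - (∑ v ∈ M.L l, pm M l v * A M s₀ l v) ^ 2

end MarkovFlow

namespace MarkovFlow

variable {V : Type} [Fintype V] [DecidableEq V]

/-- Symmetry of a Markov flow graph: an involution of the nodes preserving each layer and the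
transition probabilities, swapping `s₀` with `s₁` and `t₀` with `t₁`. -/
def Symm (M : MarkovFlow V) (s₀ s₁ t₀ t₁ : V) : Prop :=
  ∃ σ : V → V, (∀ u, σ (σ u) = u) ∧
    (∀ l, l ≤ M.N → ∀ u ∈ M.L l, σ u ∈ M.L l) ∧
    σ s₀ = s₁ ∧ σ t₀ = t₁ ∧ ∀ u v, M.q (σ u) (σ v) = M.q u v

/-- The capacity of the edge `(u,v)`, namely `p(u,v) = p(u)·q(u,v)` when `u` lies in some layer
`l < N` (and `0` otherwise). -/
noncomputable def ecap (M : MarkovFlow V) (u v : V) : ℝ :=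
  ∑ l ∈ Finset.range M.N, if u ∈ M.L l then pm M l u * M.q u v else 0

/-- `g` is a capacity-respecting flow from `s₀` to `t₁` of value `F`. -/
def IsFlow (M : MarkovFlow V) (s₀ s₁ t₀ t₁ : V) (g : V → V → ℝ) (F : ℝ) : Prop :=
  (∀ l, l < M.N → ∀ u ∈ M.L l, ∀ v ∈ M.L (l + 1),
      0 ≤ g u v ∧ g u v ≤ pm M l u * M.q u v) ∧
  (∀ v, g s₁ v = 0) ∧ (∀ u, g u t₀ = 0) ∧
  (∀ l, 0 < l → l < M.N → ∀ w ∈ M.L l,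
      ∑ u ∈ M.L (l - 1), g u w = ∑ v ∈ M.L (l + 1), g w v) ∧
  ∑ v ∈ M.L 1, g s₀ v = F

/-- A set `T` of edges separates `s₀` from `t₁`: every positive-capacity layered path from `s₀`
to `t₁` uses an edge of `T`. -/
def Separates (M : MarkovFlow V) (s₀ t₁ : V) (T : Finset (V × V)) : Prop :=
  ∀ u : ℕ → V, u 0 = s₀ → u M.N = t₁ → (∀ l, l ≤ M.N → u l ∈ M.L l) →
    (∀ l, l < M.N → 0 < pm M l (u l) * M.q (u l) (u (l + 1))) →
    ∃ l, l < M.N ∧ (u l, u (l + 1)) ∈ T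

end MarkovFlow

open MarkovFlow in
/-- `M` realizes the Markov flow graph `H_k(N,ε)` of the lower-bound construction, with
sources `s₀,s₁`, sinks `t₀,t₁`, and inner-layer nodes `v j 0, …, v j (k-1)` for `0 < j < N`:
the listed edge capacities, all other capacities `0`. -/
def IsHkGraph {V : Type} [Fintype V] [DecidableEq V] (M : MarkovFlow V)
    (k N : ℕ) (ε : ℝ) (s₀ s₁ t₀ t₁ : V) (v : ℕ → ℕ → V) : Prop :=
  M.N = N ∧
  M.L 0 = {s₀, s₁} ∧ s₀ ≠ s₁ ∧ M.p0 s₀ = 1 / 2 ∧ M.p0 s₁ = 1 / 2 ∧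
  M.L N = {t₀, t₁} ∧ t₀ ≠ t₁ ∧
  (∀ j, 1 ≤ j → j ≤ N - 1 →
    M.L j = (Finset.range k).image (v j) ∧ (M.L j).card = k) ∧
  -- first layer of edges
  (∀ i, i < k → ecap M s₀ (v 1 i) =
    (if i = 0 then 1 / 2 - ((k : ℝ) - 2) * ε
     else if i ≤ k - 2 then 2 * ε * ((k : ℝ) - 1 - (i : ℝ)) / ((k : ℝ) - 1)
     else 0)) ∧
  (∀ i, i < k → ecap M s₁ (v 1 i) =
    (if i = k - 1 then 1 / 2 - ((k : ℝ) - 2) * ε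
     else if 1 ≤ i then 2 * ε * (i : ℝ) / ((k : ℝ) - 1)
     else 0)) ∧
  -- middle layers of edges
  (∀ j, 1 ≤ j → j ≤ N - 2 → ∀ a, a < k → ∀ b, b < k →
    ecap M (v j a) (v (j + 1) b) =
      (if 1 ≤ b ∧ b ≤ k - 2 ∧ (a + 1 = b ∨ a = b + 1) then ε
       else if a = b ∧ (a = 0 ∨ a = k - 1) then 1 / 2 - ((j : ℝ) + (k : ℝ) - 2) * ε
       else if a = b ∧ (a = 1 ∨ a = k - 2) then (j : ℝ) * ε
       else 0)) ∧
  -- last layer of edges: nodes `v (N-1) i` with `i < k/2` send their full mass to `t₀`,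
  -- the others send their full mass to `t₁`
  (∀ i, i < k → ecap M (v (N - 1) i) t₀ =
    (if i < k / 2 then pm M (N - 1) (v (N - 1) i) else 0)) ∧
  (∀ i, i < k → ecap M (v (N - 1) i) t₁ =
    (if k / 2 ≤ i then pm M (N - 1) (v (N - 1) i) else 0))

namespace MarkovFlow

variable {V : Type} [Fintype V] [DecidableEq V]

lemma q_eq_zero_of_notMem (M : MarkovFlow V) {l : ℕ} (hl : l < M.N) {u w : V}
    (hw : w ∈ M.L (l + 1)) (hu : u ∉ M.L l) : M.q u w = 0 := by
  by_contra h
  obtain ⟨m, hm, hum, hwm⟩ := M.q_supp u w h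
  rcases eq_or_ne m l with rfl | hne
  · exact hu hum
  · exact Finset.disjoint_left.mp
      (M.layer_disjoint (m + 1) (l + 1) (by omega) (by omega) (by omega)) hwm hw

lemma sum_mul_q_eq (M : MarkovFlow V) {l : ℕ} (hl : l < M.N) {w : V}
    (hw : w ∈ M.L (l + 1)) (f : V → ℝ) :
    ∑ u, f u * M.q u w = ∑ u ∈ M.L l, f u * M.q u w := by
  refine (Finset.sum_subset (Finset.subset_univ _) fun u _ hu => ?_).symm
  rw [M.q_eq_zero_of_notMem hl hw hu, mul_zero]

lemma ecap_eq (M : MarkovFlow V) {l : ℕ} (hl : l < M.N) {u : V} (hu : u ∈ M.L l) (w : V) :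
    M.ecap u w = M.pm l u * M.q u w := by
  unfold ecap
  rw [Finset.sum_eq_single l, if_pos hu]
  · intro m hm hne
    refine if_neg fun hum => ?_
    exact Finset.disjoint_left.mp
      (M.layer_disjoint m l (Finset.mem_range.mp hm).le hl.le hne) hum hu
  · exact fun h => absurd (Finset.mem_range.mpr hl) h

lemma pm_succ_eq_sum_ecap (M : MarkovFlow V) {l : ℕ} (hl : l < M.N) {w : V}
    (hw : w ∈ M.L (l + 1)) : M.pm (l + 1) w = ∑ u ∈ M.L l, M.ecap u w :=
  (M.sum_mul_q_eq hl hw _).trans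
    (Finset.sum_congr rfl fun _ hu => (M.ecap_eq hl hu w).symm)

lemma pj_zero_succ (M : MarkovFlow V) (s : V) {l : ℕ} (hl : l < M.N) {w : V}
    (hw : w ∈ M.L (l + 1)) : M.pj 0 (l + 1) s w = ∑ u ∈ M.L l, M.pj 0 l s u * M.q u w := by
  have h := M.sum_mul_q_eq hl hw (M.cond s l)
  simp only [pj, Nat.sub_zero, cond, h, Finset.mul_sum, mul_assoc]

lemma pj_zero_one (M : MarkovFlow V) {s : V} (hs : s ∈ M.L 0) (w : V) :
    M.pj 0 1 s w = M.ecap s w := by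
  rw [M.ecap_eq M.one_le_N hs]
  simp [pj, cond]

lemma pm_nonneg (M : MarkovFlow V) (l : ℕ) (u : V) : 0 ≤ M.pm l u := by
  induction l generalizing u with
  | zero => exact M.p0_nonneg u
  | succ l ih => exact Finset.sum_nonneg fun w _ => mul_nonneg (ih w) (M.q_nonneg w u)

lemma ecap_nonneg (M : MarkovFlow V) (u w : V) : 0 ≤ M.ecap u w := by
  refine Finset.sum_nonneg fun l _ => ?_
  split_ifs
  · exact mul_nonneg (M.pm_nonneg l u) (M.q_nonneg u w)
  · exact le_rfl

end MarkovFlow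

namespace IsHkGraph

variable {V : Type} [Fintype V] [DecidableEq V] {M : MarkovFlow V} {k N : ℕ} {ε : ℝ}
  {s₀ s₁ t₀ t₁ : V} {v : ℕ → ℕ → V}

lemma mem_layer (hH : IsHkGraph M k N ε s₀ s₁ t₀ t₁ v) {j i : ℕ} (hj : 1 ≤ j) (hjN : j ≤ N - 1)
    (hi : i < k) : v j i ∈ M.L j := by
  obtain ⟨-, -, -, -, -, -, -, hL, -⟩ := hH
  rw [(hL j hj hjN).1]
  exact Finset.mem_image_of_mem _ (Finset.mem_range.mpr hi)

lemma sum_layer (hH : IsHkGraph M k N ε s₀ s₁ t₀ t₁ v) {j : ℕ} (hj : 1 ≤ j) (hjN : j ≤ N - 1)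
    (f : V → ℝ) : ∑ u ∈ M.L j, f u = ∑ a ∈ Finset.range k, f (v j a) := by
  obtain ⟨-, -, -, -, -, -, -, hL, -⟩ := hH
  obtain ⟨himg, hcard⟩ := hL j hj hjN
  rw [himg] at hcard ⊢
  exact Finset.sum_image (Finset.card_image_iff.mp (by rw [hcard, Finset.card_range]))

/-- On the first inner layer the marginals are positive and `p(s₀,v_i) = (1 - i/(k-1)) p(v_i)`. -/
lemma first_layer (hH : IsHkGraph M k N ε s₀ s₁ t₀ t₁ v) (hk : 4 ≤ k) (hN : 2 ≤ N)
    (hε : 0 < ε) (hcap : ((k : ℝ) - 2) * ε < 1 / 2) {i : ℕ} (hi : i < k) :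
    0 < M.pm 1 (v 1 i) ∧
      M.pj 0 1 s₀ (v 1 i) = (1 - (i : ℝ) / ((k : ℝ) - 1)) * M.pm 1 (v 1 i) := by
  have hw := hH.mem_layer le_rfl (by omega) hi
  obtain ⟨-, hL0, hne, -, -, -, -, -, h0, h1, -⟩ := hH
  have hK : (0 : ℝ) < (k : ℝ) - 1 := by
    have : (4 : ℝ) ≤ k := by exact_mod_cast hk
    linarith
  rw [M.pj_zero_one (by simp [hL0]), M.pm_succ_eq_sum_ecap M.one_le_N hw, hL0,
    Finset.sum_pair hne, h0 i hi, h1 i hi]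
  by_cases hi0 : i = 0
  · subst hi0
    rw [if_pos rfl, if_neg (by omega), if_neg (by omega)]
    exact ⟨by linarith, by simp⟩
  by_cases hiK : i = k - 1
  · have hcast : (i : ℝ) = (k : ℝ) - 1 := by
      rw [hiK, Nat.cast_sub (by omega), Nat.cast_one]
    rw [if_neg hi0, if_neg (by omega), if_pos hiK, hcast, div_self hK.ne']
    exact ⟨by linarith, by simp⟩
  · rw [if_neg hi0, if_pos (by omega), if_neg hiK, if_pos (by omega)]
    have hsum : 2 * ε * ((k : ℝ) - 1 - i) / ((k : ℝ) - 1) + 2 * ε * i / ((k : ℝ) - 1) = 2 * ε := by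
      field_simp
      ring
    rw [hsum]
    refine ⟨by positivity, ?_⟩
    field_simp

/-- The capacities into each inner node balance around its index. -/
lemma sum_sub_mul_ecap (hH : IsHkGraph M k N ε s₀ s₁ t₀ t₁ v) {j : ℕ} (hj : 1 ≤ j)
    (hjN : j ≤ N - 2) {b : ℕ} (hb : b < k) :
    ∑ a ∈ Finset.range k, ((a : ℝ) - b) * M.ecap (v j a) (v (j + 1) b) = 0 := by
  obtain ⟨-, -, -, -, -, -, -, -, -, -, hmid, -⟩ := hH
  by_cases hint : 1 ≤ b ∧ b ≤ k - 2
  · have hterm : ∀ a ∈ Finset.range k, ((a : ℝ) - b) * M.ecap (v j a) (v (j + 1) b) =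
        (if a = b - 1 then -ε else 0) + (if a = b + 1 then ε else 0) := by
      intro a ha
      rw [hmid j hj hjN a (Finset.mem_range.mp ha) b hb]
      rcases eq_or_ne a b with rfl | hab
      · rw [if_neg (show ¬ a = a - 1 by omega), if_neg (show ¬ a = a + 1 by omega)]
        simp
      by_cases h1 : a + 1 = b
      · rw [if_pos ⟨hint.1, hint.2, Or.inl h1⟩, if_pos (by omega), if_neg (by omega), ← h1]
        push_cast
        ring
      by_cases h2 : a = b + 1
      · rw [if_pos ⟨hint.1, hint.2, Or.inr h2⟩, if_neg (by omega), if_pos h2, h2]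
        push_cast
        ring
      · rw [if_neg (by omega), if_neg (by omega), if_neg (by omega), if_neg (by omega),
          if_neg h2]
        simp
    rw [Finset.sum_congr rfl hterm, Finset.sum_add_distrib, Finset.sum_ite_eq',
      Finset.sum_ite_eq', if_pos (Finset.mem_range.mpr (by omega)),
      if_pos (Finset.mem_range.mpr (by omega)), neg_add_cancel]
  · refine Finset.sum_eq_zero fun a ha => ?_
    rw [hmid j hj hjN a (Finset.mem_range.mp ha) b hb]
    rcases eq_or_ne a b with rfl | hab
    · simp
    · rw [if_neg (by omega), if_neg (by omega), if_neg (by omega), mul_zero]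

lemma sum_ecap_pos (hH : IsHkGraph M k N ε s₀ s₁ t₀ t₁ v) {j : ℕ} (hj : 1 ≤ j)
    (hjN : j ≤ N - 2) (hε : 0 < ε) (hcap : ((j : ℝ) + k - 2) * ε < 1 / 2) {b : ℕ} (hb : b < k) :
    0 < ∑ a ∈ Finset.range k, M.ecap (v j a) (v (j + 1) b) := by
  obtain ⟨-, -, -, -, -, -, -, -, -, -, hmid, -⟩ := hH
  refine Finset.sum_pos' (fun a _ => M.ecap_nonneg _ _) ?_
  by_cases hint : 1 ≤ b ∧ b ≤ k - 2
  · refine ⟨b - 1, Finset.mem_range.mpr (by omega), ?_⟩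
    rw [hmid j hj hjN _ (by omega) b hb, if_pos (by omega)]
    exact hε
  · refine ⟨b, Finset.mem_range.mpr hb, ?_⟩
    rw [hmid j hj hjN b hb b hb, if_neg (by omega), if_pos (by omega)]
    linarith

/-- On every inner layer the marginals are positive and `p(s₀,v_i) = (1 - i/(k-1)) p(v_i)`. -/
lemma inner_layer (hH : IsHkGraph M k N ε s₀ s₁ t₀ t₁ v) (hk : 4 ≤ k) (hN : 2 ≤ N)
    (hε : 0 < ε) (hcap : ((N : ℝ) + k) * ε < 1 / 2) {j : ℕ} (hj : 1 ≤ j) (hjN : j ≤ N - 1) :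
    ∀ i, i < k → 0 < M.pm j (v j i) ∧
      M.pj 0 j s₀ (v j i) = (1 - (i : ℝ) / ((k : ℝ) - 1)) * M.pm j (v j i) := by
  induction j, hj using Nat.le_induction with
  | base =>
    intro i hi
    refine hH.first_layer hk hN hε ?_ hi
    nlinarith [mul_nonneg (Nat.cast_nonneg (α := ℝ) N) hε.le]
  | succ j hj ih =>
    intro b hb
    have hlN : j < M.N := by
      rw [hH.1]
      omega
    have hw := hH.mem_layer (by omega) hjN hb
    have hpm : M.pm (j + 1) (v (j + 1) b) =
        ∑ a ∈ Finset.range k, M.ecap (v j a) (v (j + 1) b) := by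
      rw [M.pm_succ_eq_sum_ecap hlN hw, hH.sum_layer hj (by omega)]
    have hpj : M.pj 0 (j + 1) s₀ (v (j + 1) b) =
        ∑ a ∈ Finset.range k,
          (1 - (a : ℝ) / ((k : ℝ) - 1)) * M.ecap (v j a) (v (j + 1) b) := by
      rw [M.pj_zero_succ s₀ hlN hw, hH.sum_layer hj (by omega)]
      refine Finset.sum_congr rfl fun a ha => ?_
      have ha := Finset.mem_range.mp ha
      rw [(ih (by omega) a ha).2, M.ecap_eq hlN (hH.mem_layer hj (by omega) ha), mul_assoc]
    refine ⟨?_, ?_⟩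
    · rw [hpm]
      refine hH.sum_ecap_pos hj (by omega) hε ?_ hb
      have : (j : ℝ) ≤ N := by exact_mod_cast (by omega : j ≤ N)
      nlinarith [mul_le_mul_of_nonneg_right this hε.le]
    · have hbal := hH.sum_sub_mul_ecap hj (by omega) hb
      rw [hpm, hpj, Finset.mul_sum, ← sub_eq_zero, ← Finset.sum_sub_distrib]
      rw [← mul_zero (-((k : ℝ) - 1)⁻¹), ← hbal, Finset.mul_sum]
      refine Finset.sum_congr rfl fun a _ => ?_
      ring

end IsHkGraph

/-- Claim in Section 6 of the paper, part 1: in the lower-bound construction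
`H_k(N,ε)`, for every inner layer `1 ≤ j ≤ N−1` and every `0 ≤ i ≤ k−1`,
`A(v^j_i) = 1/2 − i/(k−1)`. -/
theorem stmt15 (k N : ℕ) (ε : ℝ) (hk4 : 4 ≤ k) (hkeven : Even k) (hkN : k < N)
    (hε0 : 0 < ε) (hε1 : ε < 1 / (2 * ((N : ℝ) + (k : ℝ))))
    (V : Type) [Fintype V] [DecidableEq V]
    (M : MarkovFlow V) (s₀ s₁ t₀ t₁ : V) (v : ℕ → ℕ → V)
    (hH : IsHkGraph M k N ε s₀ s₁ t₀ t₁ v) :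
    ∀ j, 1 ≤ j → j ≤ N - 1 → ∀ i, i < k →
      MarkovFlow.A M s₀ j (v j i) = 1 / 2 - (i : ℝ) / ((k : ℝ) - 1) := by
  intro j hj hjN i hi
  have hcap : ((N : ℝ) + k) * ε < 1 / 2 := by
    have hpos : (0 : ℝ) < 2 * ((N : ℝ) + k) := by
      have : (0 : ℝ) < k := by exact_mod_cast (by omega : 0 < k)
      positivity
    rw [lt_div_iff₀ hpos] at hε1
    linarith
  obtain ⟨hpos, heq⟩ := hH.inner_layer hk4 (by omega) hε0 hcap hj hjN i hi
  rw [MarkovFlow.A, heq, mul_div_cancel_right₀ _ hpos.ne']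
  ring
end
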